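/- arXiv:1705.01724 — 4 statements merged into one kernel-verified Lean document; each statement's English description precedes it below -/
import Mathlib

section
/- Assume the standing hypotheses on g₀, g₁, …, g_m and the compact sets U, V, and fix x̄₀ ∈ ℝ^n, ū₀ ∈ U, T > 0. Let u : [0,T] → U with u(0)=ū₀ be absolutely continuous on [0,t] for every t < T and let v : [0,T] → V be measurable. Let (φ₀,φ,ψ,S) be a BV_loc graph completion of (u,v), let σ be a clock, let ξ be the space-time solution with initial datum x̄₀ corresponding to (φ₀,φ,ψ), and set x(t) := ξ(σ(t)) for t ∈ [0,T). If x is absolutely continuous on [0,t] for every t < T, then x(t) = x̄₀ + ∫₀ᵗ [g₀(x(τ),u(τ),v(τ)) + Σ_{i=1}^m g_i(x(τ),u(τ)) u̇_i(τ)] dτ for all t ∈ [0,T), i.e. x coincides with the Carathéodory solution of the impulsive system corresponding to (u,v). -/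
open MeasureTheory Set Filter Topology
open scoped ENNReal

noncomputable section

/-- `f` is absolutely continuous on `[0,t]` for every `t < T`:
its (a.e. existing) derivative is locally integrable and FTC holds. -/
def ACloc {E : Type*} [NormedAddCommGroup E] [NormedSpace ℝ E] (f : ℝ → E) (T : ℝ) : Prop :=
  ∀ t ∈ Ico (0:ℝ) T, IntervalIntegrable (deriv f) volume 0 t ∧
    ∀ τ ∈ Icc (0:ℝ) t, f τ = f 0 + ∫ r in (0:ℝ)..τ, deriv f r

/-- Standing hypotheses on the data of the impulsive control system. -/
def StandingHyp {n m q : ℕ} (U : Set (EuclideanSpace ℝ (Fin m)))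
    (V : Set (EuclideanSpace ℝ (Fin q)))
    (g0 : EuclideanSpace ℝ (Fin n) → EuclideanSpace ℝ (Fin m) → EuclideanSpace ℝ (Fin q) →
      EuclideanSpace ℝ (Fin n))
    (g : Fin m → EuclideanSpace ℝ (Fin n) → EuclideanSpace ℝ (Fin m) →
      EuclideanSpace ℝ (Fin n))
    (M : ℝ) : Prop :=
  IsCompact U ∧ IsCompact V ∧
  -- g₀ continuous on ℝⁿ × U × V
  ContinuousOn (fun p : (EuclideanSpace ℝ (Fin n) × EuclideanSpace ℝ (Fin m)) ×
      EuclideanSpace ℝ (Fin q) => g0 p.1.1 p.1.2 p.2) ((univ ×ˢ U) ×ˢ V) ∧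
  -- (x,u) ↦ g₀(x,u,v) locally Lipschitz, uniformly in v ∈ V
  (∀ R > (0:ℝ), ∃ L ≥ (0:ℝ), ∀ v' ∈ V, ∀ x1 x2 : EuclideanSpace ℝ (Fin n),
    ∀ u1 ∈ U, ∀ u2 ∈ U, ‖x1‖ ≤ R → ‖x2‖ ≤ R →
      ‖g0 x1 u1 v' - g0 x2 u2 v'‖ ≤ L * (‖x1 - x2‖ + ‖u1 - u2‖)) ∧
  -- each gᵢ locally Lipschitz
  (∀ i : Fin m, ∀ R > (0:ℝ), ∃ L ≥ (0:ℝ), ∀ x1 x2 : EuclideanSpace ℝ (Fin n),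
    ∀ u1 ∈ U, ∀ u2 ∈ U, ‖x1‖ ≤ R → ‖x2‖ ≤ R →
      ‖g i x1 u1 - g i x2 u2‖ ≤ L * (‖x1 - x2‖ + ‖u1 - u2‖)) ∧
  -- sublinear growth: |(g₀,g₁,…,g_m)| ≤ M(1+|(x,u)|)
  0 < M ∧
  ∀ (x : EuclideanSpace ℝ (Fin n)), ∀ u' ∈ U, ∀ v' ∈ V,
    Real.sqrt (‖g0 x u' v'‖ ^ 2 + ∑ i, ‖g i x u'‖ ^ 2) ≤
      M * (1 + Real.sqrt (‖x‖ ^ 2 + ‖u'‖ ^ 2))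

/-- `ξ` is a space-time solution with initial datum `x0` corresponding to `(φ₀,φ,ψ)`,
on the domain `D`. -/
def IsSTSol {n m q : ℕ}
    (g0 : EuclideanSpace ℝ (Fin n) → EuclideanSpace ℝ (Fin m) → EuclideanSpace ℝ (Fin q) →
      EuclideanSpace ℝ (Fin n))
    (g : Fin m → EuclideanSpace ℝ (Fin n) → EuclideanSpace ℝ (Fin m) →
      EuclideanSpace ℝ (Fin n))
    (x0 : EuclideanSpace ℝ (Fin n)) (phi0 : ℝ → ℝ) (phi : ℝ → EuclideanSpace ℝ (Fin m))
    (psi : ℝ → EuclideanSpace ℝ (Fin q)) (xi : ℝ → EuclideanSpace ℝ (Fin n))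
    (D : Set ℝ) : Prop :=
  ∀ s ∈ D, xi s = x0 + ∫ r in (0:ℝ)..s,
    ((deriv phi0 r) • g0 (xi r) (phi r) (psi r) +
      ∑ i, ((deriv phi r) i) • g i (xi r) (phi r))

theorem bound_aux {E : Type*} [NormedAddCommGroup E] [NormedSpace ℝ E] [CompleteSpace E]
    (F ξ : ℝ → E) (x0 : E) (K a : ℝ) (ha : 0 ≤ a) (hK : 0 ≤ K)
    (hxi : ∀ s ∈ Icc 0 a, ξ s = x0 + ∫ r in (0:ℝ)..s, F r)
    (hc : ContinuousOn ξ (Icc 0 a))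
    (hbd : ∀ r ∈ Ioo 0 a, ‖F r‖ ≤ K * (1 + ‖ξ r‖)) :
    ‖ξ a‖ ≤ ‖x0‖ + gronwallBound 0 K (K * (1 + ‖x0‖)) a := by
  set h : ℝ → E := IccExtend ha ((Icc 0 a).domRestrict ξ) with hh
  have hcont : Continuous h := (continuousOn_iff_continuous_domRestrict.mp hc).Icc_extend'
  have heq : ∀ s ∈ Icc 0 a, h s = ξ s := fun s hs => by
    rw [hh, IccExtend_of_mem ha _ hs]; rfl
  have hkc : Continuous (fun r => K * (1 + ‖h r‖)) := by fun_prop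
  set f : ℝ → ℝ := fun s => ∫ r in (0:ℝ)..s, K * (1 + ‖h r‖) with hf
  have hfd : ∀ s, HasDerivAt f (K * (1 + ‖h s‖)) s := fun s =>
    (hkc.integral_hasStrictDerivAt 0 s).hasDerivAt
  have hfn : ∀ s ∈ Icc 0 a, 0 ≤ f s := fun s hs =>
    intervalIntegral.integral_nonneg hs.1 (fun r _ => by positivity)
  have hle : ∀ s ∈ Icc 0 a, ‖ξ s‖ ≤ ‖x0‖ + f s := by
    intro s hs
    rw [hxi s hs]
    refine (norm_add_le _ _).trans (by
      gcongr
      refine intervalIntegral.norm_integral_le_of_norm_le hs.1 ?_ (hkc.intervalIntegrable _ _)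
      have : ∀ᵐ r ∂(volume : Measure ℝ), r ≠ a := by simp [ae_iff]
      filter_upwards [this] with r hr hr2
      have hrm : r ∈ Icc 0 a := ⟨hr2.1.le, hr2.2.trans hs.2⟩
      rw [heq r hrm]
      exact hbd r ⟨hr2.1, lt_of_le_of_ne hrm.2 hr⟩)
  have hg := norm_le_gronwallBound_of_norm_deriv_right_le (f := f)
    (f' := fun s => K * (1 + ‖h s‖)) (δ := 0) (K := K) (ε := K * (1 + ‖x0‖)) (a := 0) (b := a)
    (fun s _ => (hfd s).continuousAt.continuousWithinAt)
    (fun s _ => (hfd s).hasDerivWithinAt) (by simp [hf]) (by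
      intro s hs
      have hs' := Ico_subset_Icc_self hs
      rw [heq s hs', Real.norm_of_nonneg (by positivity), Real.norm_of_nonneg (hfn s hs')]
      have := mul_le_mul_of_nonneg_left (hle s hs') hK
      nlinarith) a ⟨ha, le_rfl⟩
  rw [sub_zero, Real.norm_of_nonneg (hfn a ⟨ha, le_rfl⟩)] at hg
  linarith [hle a ⟨ha, le_rfl⟩]

theorem integrable_aux {E : Type*} [NormedAddCommGroup E] [NormedSpace ℝ E] [CompleteSpace E]
    [SecondCountableTopology E]
    (F ξ : ℝ → E) (x0 : E) (K s1 : ℝ) (hs1 : 0 ≤ s1) (hK : 0 ≤ K)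
    (hxi : ∀ s ∈ Icc 0 s1, ξ s = x0 + ∫ r in (0:ℝ)..s, F r)
    (hbd : ∀ r ∈ Ioo 0 s1, ‖F r‖ ≤ K * (1 + ‖ξ r‖))
    (hmeas : AEStronglyMeasurable ξ (volume.restrict (Ioc 0 s1)) →
      AEStronglyMeasurable F (volume.restrict (Ioc 0 s1))) :
    IntervalIntegrable F volume 0 s1 := by
  set A : Set ℝ := {s | s ∈ Icc 0 s1 ∧ IntervalIntegrable F volume 0 s} with hA
  have hdown : ∀ a ∈ A, ∀ s ∈ Icc 0 a, s ∈ A := by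
    intro a ha s hs
    refine ⟨⟨hs.1, hs.2.trans ha.1.2⟩, ha.2.mono_set ?_⟩
    rw [uIcc_of_le hs.1, uIcc_of_le ha.1.1]
    exact Icc_subset_Icc_right hs.2
  have hcIcc : ∀ a ∈ A, ContinuousOn ξ (Icc 0 a) := by
    intro a ha
    have h1 := intervalIntegral.continuousOn_primitive_interval (f := F) (μ := volume)
      (a := 0) (b := a) (by
        rw [uIcc_of_le ha.1.1, integrableOn_Icc_iff_integrableOn_Ioc]
        exact (intervalIntegrable_iff_integrableOn_Ioc_of_le ha.1.1).mp ha.2)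
    rw [uIcc_of_le ha.1.1] at h1
    exact (continuousOn_const.add h1).congr fun s hs => hxi s ⟨hs.1, hs.2.trans ha.1.2⟩
  have hcA : ContinuousOn ξ A := by
    intro s hs
    by_cases hb : ∃ b ∈ A, s < b
    · obtain ⟨b, hbA, hsb⟩ := hb
      refine (hcIcc b hbA s ⟨hs.1.1, hsb.le⟩).mono_of_mem_nhdsWithin ?_
      filter_upwards [self_mem_nhdsWithin, nhdsWithin_le_nhds (Iio_mem_nhds hsb)] with r hr hr2
      exact ⟨hr.1.1, le_of_lt hr2⟩
    · push Not at hb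
      exact (hcIcc s hs s ⟨hs.1.1, le_rfl⟩).mono fun r hr => ⟨hr.1.1, hb r hr⟩
  have hAm : MeasurableSet A := by
    refine OrdConnected.measurableSet ⟨fun x hx y hy z hz => hdown y hy z ⟨hx.1.1.trans hz.1, hz.2⟩⟩
  have hnA : ∀ s ∈ Icc 0 s1, s ∉ A → ξ s = x0 := by
    intro s hs hsA
    rw [hxi s hs, intervalIntegral.integral_undef (fun h => hsA ⟨hs, h⟩), add_zero]
  set C := ‖x0‖ + gronwallBound 0 K (K * (1 + ‖x0‖)) s1 with hC
  have hmono := gronwallBound_mono (δ := 0) (K := K) (ε := K * (1 + ‖x0‖)) le_rfl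
    (by positivity) hK
  have hbC : ∀ s ∈ Icc 0 s1, ‖ξ s‖ ≤ C := by
    intro s hs
    by_cases hsA : s ∈ A
    · have := bound_aux F ξ x0 K s hs.1 hK (fun r hr => hxi r ⟨hr.1, hr.2.trans hs.2⟩)
        (hcIcc s hsA) (fun r hr => hbd r ⟨hr.1, hr.2.trans_le hs.2⟩)
      have := hmono hs.2
      linarith
    · rw [hnA s hs hsA]
      have := hmono hs1
      rw [gronwallBound_x0] at this
      linarith
  have hxm : AEStronglyMeasurable ξ (volume.restrict (Ioc 0 s1)) := by
    have h1 : AEStronglyMeasurable ξ (volume.restrict A) := hcA.aestronglyMeasurable hAm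
    have h2 : AEStronglyMeasurable ξ (volume.restrict (Icc 0 s1 \ A)) := by
      refine (aestronglyMeasurable_const (b := x0)).congr ?_
      filter_upwards [ae_restrict_mem (measurableSet_Icc.diff hAm)] with s hs
      exact (hnA s hs.1 hs.2).symm
    refine (aestronglyMeasurable_union_iff.mpr ⟨h1, h2⟩).mono_set ?_
    intro s hs
    by_cases hsA : s ∈ A
    · exact Or.inl hsA
    · exact Or.inr ⟨⟨hs.1.le, hs.2⟩, hsA⟩
  rw [intervalIntegrable_iff_integrableOn_Ioc_of_le hs1]
  refine Integrable.of_bound (hmeas hxm) (K * (1 + C)) ?_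
  have : ∀ᵐ r ∂(volume.restrict (Ioc 0 s1)), r ≠ s1 := ae_restrict_of_ae (by simp [ae_iff])
  filter_upwards [ae_restrict_mem measurableSet_Ioc, this] with r hr hr2
  refine (hbd r ⟨hr.1, lt_of_le_of_ne hr.2 hr2⟩).trans ?_
  gcongr
  exact hbC r ⟨hr.1.le, hr.2⟩

theorem aesm_comp_aux {X E : Type*} [TopologicalSpace X] [MeasurableSpace X]
    [OpensMeasurableSpace X]
    [NormedAddCommGroup E] [MeasurableSpace E] [BorelSpace E] [SecondCountableTopology E]
    (G : X → E) (W : Set X) (hW : MeasurableSet W) (hG : ContinuousOn G W)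
    (p : ℝ → X) (J : Set ℝ) (hJ : MeasurableSet J) (hp : AEMeasurable p (volume.restrict J))
    (hpW : ∀ r ∈ J, p r ∈ W) :
    AEStronglyMeasurable (fun r => G (p r)) (volume.restrict J) := by
  classical
  have h1 : Measurable (W.piecewise G (fun _ => (0 : E))) :=
    hG.measurable_piecewise continuousOn_const hW
  have h2 := (h1.comp_aemeasurable hp).aestronglyMeasurable
  refine h2.congr ?_
  filter_upwards [ae_restrict_mem hJ] with r hr
  simp [Set.piecewise, hpW r hr]

theorem contOn_aux {E H : Type*} [NormedAddCommGroup E] [NormedAddCommGroup H]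
    (U : Set H) (G : E → H → E)
    (hG : ∀ R > (0:ℝ), ∃ L ≥ (0:ℝ), ∀ x1 x2 : E,
      ∀ u1 ∈ U, ∀ u2 ∈ U, ‖x1‖ ≤ R → ‖x2‖ ≤ R →
      ‖G x1 u1 - G x2 u2‖ ≤ L * (‖x1 - x2‖ + ‖u1 - u2‖)) :
    ContinuousOn (fun p : E × H => G p.1 p.2) (univ ×ˢ U) := by
  rintro ⟨x, w⟩ ⟨-, hw⟩
  obtain ⟨L, hL, h⟩ := hG (‖x‖ + 1) (by positivity)
  unfold ContinuousWithinAt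
  rw [tendsto_iff_norm_sub_tendsto_zero]
  have hlim : Tendsto (fun p : E × H => L * (‖p.1 - x‖ + ‖p.2 - w‖))
      (𝓝[univ ×ˢ U] (x, w)) (𝓝 0) := by
    have : Continuous (fun p : E × H => L * (‖p.1 - x‖ + ‖p.2 - w‖)) := by fun_prop
    have := (this.tendsto (x, w)).mono_left (nhdsWithin_le_nhds (s := univ ×ˢ U))
    simpa using this
  refine squeeze_zero' (Eventually.of_forall fun _ => norm_nonneg _) ?_ hlim
  have hev : ∀ᶠ p : E × H in 𝓝[univ ×ˢ U] (x, w), ‖p.1‖ < ‖x‖ + 1 := by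
    have hc : Continuous (fun p : E × H => ‖p.1‖) := by fun_prop
    exact nhdsWithin_le_nhds ((hc.tendsto (x, w)).eventually (gt_mem_nhds (by simp)))
  filter_upwards [hev, self_mem_nhdsWithin] with p hp hpU
  exact h _ _ _ hpU.2 _ hw hp.le (by simp)

/-- Theorem 2.1 (i) (Consistency): if `u` is AC_loc and the BV_loc graph-completion solution
`x = ξ ∘ σ` is AC_loc, then `x` coincides on `[0,T)` with the Carathéodory solution
corresponding to `(u,v)`. -/
theorem stmt7 {n m q : ℕ}
    (U : Set (EuclideanSpace ℝ (Fin m))) (V : Set (EuclideanSpace ℝ (Fin q)))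
    (g0 : EuclideanSpace ℝ (Fin n) → EuclideanSpace ℝ (Fin m) → EuclideanSpace ℝ (Fin q) →
      EuclideanSpace ℝ (Fin n))
    (g : Fin m → EuclideanSpace ℝ (Fin n) → EuclideanSpace ℝ (Fin m) →
      EuclideanSpace ℝ (Fin n))
    (M : ℝ) (hst : StandingHyp U V g0 g M)
    (x0bar : EuclideanSpace ℝ (Fin n)) (u0bar : EuclideanSpace ℝ (Fin m))
    (T : ℝ) (hT : 0 < T)
    -- the control (u,v) : u ∈ AC_loc, v measurable
    (u : ℝ → EuclideanSpace ℝ (Fin m)) (hu0 : u 0 = u0bar)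
    (huU : ∀ t ∈ Icc (0:ℝ) T, u t ∈ U) (huAC : ACloc u T)
    (v : ℝ → EuclideanSpace ℝ (Fin q)) (hvmeas : Measurable v)
    (hvV : ∀ t ∈ Icc (0:ℝ) T, v t ∈ V)
    -- the BV_loc graph completion (φ₀,φ,ψ,S), with domain D = [0,S)
    (S : ℝ≥0∞) (hSpos : 0 < S)
    (D : Set ℝ) (hD : D = {s : ℝ | 0 ≤ s ∧ ENNReal.ofReal s < S})
    (phi0 : ℝ → ℝ) (phi : ℝ → EuclideanSpace ℝ (Fin m)) (psi : ℝ → EuclideanSpace ℝ (Fin q))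
    (hlip : ∀ s1 ∈ D, ∀ s2 ∈ D, |phi0 s1 - phi0 s2| + ‖phi s1 - phi s2‖ ≤ |s1 - s2|)
    (hmono : MonotoneOn phi0 D) (h00 : phi0 0 = 0) (hphi0 : phi 0 = u0bar)
    (hae : ∀ᵐ s ∂volume, s ∈ D → deriv phi0 s + ‖deriv phi s‖ = 1)
    (hrange : ∀ s ∈ D, phi0 s ∈ Icc (0:ℝ) T ∧ phi s ∈ U)
    (hpsim : Measurable psi) (hpsiV : ∀ s ∈ D, psi s ∈ V)
    -- lim_{s→S} φ₀(s) = T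
    (hlim : ∀ ε > (0:ℝ), ∃ s0 ∈ D, ∀ s ∈ D, s0 ≤ s → |phi0 s - T| < ε)
    -- the graph of (u,v) is covered
    (hgraph : ∀ t ∈ Ico (0:ℝ) T, ∃ s ∈ D, phi0 s = t ∧ phi s = u t ∧ psi s = v t)
    -- endpoint conditions
    (hendfin : S ≠ ⊤ → phi0 S.toReal = T ∧ phi S.toReal = u T)
    (hendinf : S = ⊤ → ∃ sj : ℕ → ℝ, StrictMono sj ∧ Tendsto sj atTop atTop ∧
      Tendsto (fun j => phi (sj j)) atTop (𝓝 (u T)))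
    -- the clock σ
    (sig : ℝ → ℝ) (hsig0 : sig 0 = 0) (hsigmono : MonotoneOn sig (Ico 0 T))
    (hclock : ∀ t ∈ Ico (0:ℝ) T, sig t ∈ D ∧ phi0 (sig t) = t ∧ phi (sig t) = u t)
    -- the space-time solution ξ and the graph-completion solution x = ξ ∘ σ
    (xi : ℝ → EuclideanSpace ℝ (Fin n)) (hxi : IsSTSol g0 g x0bar phi0 phi psi xi D)
    (hxAC : ACloc (fun t => xi (sig t)) T) :
    -- x = ξ ∘ σ is the Carathéodory solution corresponding to (u,v) on [0,T)
    ∀ t ∈ Ico (0:ℝ) T, xi (sig t) = x0bar + ∫ τ in (0:ℝ)..t,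
      (g0 (xi (sig τ)) (u τ) (v τ) + ∑ i, ((deriv u τ) i) • g i (xi (sig τ)) (u τ)) := by
  obtain ⟨hUc, hVc, hg0c, -, hgL, hM, hgrow⟩ := hst
  have hDdown : ∀ s ∈ D, ∀ r, 0 ≤ r → r ≤ s → r ∈ D := by
    intro s hs r hr hrs
    rw [hD] at hs ⊢
    exact ⟨hr, (ENNReal.ofReal_le_ofReal hrs).trans_lt hs.2⟩
  have hDup : ∀ s ∈ D, ∃ s' ∈ D, s < s' := by
    intro s hs
    rw [hD] at hs
    have h1 : ∀ᶠ r in 𝓝[>] s, ENNReal.ofReal r < S :=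
      nhdsWithin_le_nhds ((ENNReal.continuous_ofReal.tendsto s).eventually (gt_mem_nhds hs.2))
    obtain ⟨r, hr, hr2⟩ := (h1.and self_mem_nhdsWithin).exists
    exact ⟨r, by rw [hD]; exact ⟨hs.1.trans (le_of_lt hr2), hr⟩, hr2⟩
  have hDnhds : ∀ s ∈ D, 0 < s → D ∈ 𝓝 s := by
    intro s hs hs0
    obtain ⟨s', hs', hlt⟩ := hDup s hs
    filter_upwards [Icc_mem_nhds hs0 hlt] with r hr
    exact hDdown s' hs' r hr.1 hr.2
  have hlip0 : LipschitzOnWith 1 phi0 D := LipschitzOnWith.of_dist_le_mul fun a ha b hb => by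
    rw [Real.dist_eq, Real.dist_eq, NNReal.coe_one, one_mul]
    linarith [hlip a ha b hb, norm_nonneg (phi a - phi b)]
  have hlip1 : LipschitzOnWith 1 phi D := LipschitzOnWith.of_dist_le_mul fun a ha b hb => by
    rw [dist_eq_norm, Real.dist_eq, NNReal.coe_one, one_mul]
    linarith [hlip a ha b hb, abs_nonneg (phi0 a - phi0 b)]
  set F : ℝ → EuclideanSpace ℝ (Fin n) := fun r =>
    ((deriv phi0 r) • g0 (xi r) (phi r) (psi r) +
      ∑ i, ((deriv phi r) i) • g i (xi r) (phi r)) with hF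
  have hxi' : ∀ s ∈ D, xi s = x0bar + ∫ r in (0:ℝ)..s, F r := hxi
  obtain ⟨B, hB⟩ := hUc.isBounded.exists_norm_le
  -- integrability of the space-time integrand
  have hint : ∀ s1 ∈ D, IntervalIntegrable F volume 0 s1 := by
    intro s1 hs1
    have hs10 : 0 ≤ s1 := by rw [hD] at hs1; exact hs1.1
    have hsub : ∀ r ∈ Ioc 0 s1, r ∈ D := fun r hr => hDdown s1 hs1 r hr.1.le hr.2
    refine integrable_aux F xi x0bar ((1 + m) * (M * (1 + |B|))) s1 hs10 (by positivity)
      (fun s hs => hxi' s (hDdown s1 hs1 s hs.1 hs.2)) ?_ ?_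
    · intro r hr
      have hrD := hsub r ⟨hr.1, hr.2.le⟩
      have hn := hDnhds r hrD hr.1
      have hd0 : ‖deriv phi0 r‖ ≤ 1 := by simpa using norm_deriv_le_of_lipschitzOn hn hlip0
      have hd1 : ‖deriv phi r‖ ≤ 1 := by simpa using norm_deriv_le_of_lipschitzOn hn hlip1
      set Q := M * (1 + |B|) * (1 + ‖xi r‖) with hQ
      have hsq : M * (1 + Real.sqrt (‖xi r‖ ^ 2 + ‖phi r‖ ^ 2)) ≤ Q := by
        have h1 : Real.sqrt (‖xi r‖ ^ 2 + ‖phi r‖ ^ 2) ≤ ‖xi r‖ + |B| := by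
          have hb : ‖phi r‖ ≤ |B| := (hB _ (hrange r hrD).2).trans (le_abs_self B)
          rw [Real.sqrt_le_left (by positivity)]
          nlinarith [norm_nonneg (xi r), norm_nonneg (phi r), abs_nonneg B,
            mul_nonneg (norm_nonneg (xi r)) (abs_nonneg B)]
        rw [hQ, mul_assoc]
        refine mul_le_mul_of_nonneg_left ?_ hM.le
        nlinarith [mul_nonneg (norm_nonneg (xi r)) (abs_nonneg B)]
      have hgr := (hgrow (xi r) (phi r) (hrange r hrD).2 (psi r) (hpsiV r hrD)).trans hsq
      have hQ0 : 0 ≤ Q := by positivity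
      have hg0b : ‖g0 (xi r) (phi r) (psi r)‖ ≤ Q := by
        refine le_trans (Real.le_sqrt_of_sq_le ?_) hgr
        have : 0 ≤ ∑ i, ‖g i (xi r) (phi r)‖ ^ 2 := Finset.sum_nonneg fun i _ => by positivity
        linarith
      have hgib : ∀ i, ‖g i (xi r) (phi r)‖ ≤ Q := by
        intro i
        refine le_trans (Real.le_sqrt_of_sq_le ?_) hgr
        have := Finset.single_le_sum (f := fun i => ‖g i (xi r) (phi r)‖ ^ 2)
          (fun i _ => by positivity) (Finset.mem_univ i)
        have h2 := sq_nonneg ‖g0 (xi r) (phi r) (psi r)‖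
        linarith
      have e1 : ‖(deriv phi0 r) • g0 (xi r) (phi r) (psi r)‖ ≤ Q := by
        rw [norm_smul]
        calc _ ≤ 1 * Q := by gcongr
          _ = Q := one_mul _
      have e2 : ‖∑ i, ((deriv phi r) i) • g i (xi r) (phi r)‖ ≤ m * Q := by
        have : ∀ i ∈ Finset.univ, ‖((deriv phi r) i) • g i (xi r) (phi r)‖ ≤ Q := by
          intro i _
          rw [norm_smul]
          calc _ ≤ 1 * Q := by
                gcongr
                · exact (PiLp.norm_apply_le _ i).trans hd1
                · exact hgib i
            _ = Q := one_mul _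
        refine (norm_sum_le_of_le _ this).trans ?_
        simp
      calc ‖F r‖ ≤ Q + m * Q := (norm_add_le _ _).trans (add_le_add e1 e2)
        _ = _ := by rw [hQ]; ring
    · intro hxm
      have hphim : AEMeasurable phi (volume.restrict (Ioc 0 s1)) :=
        ((hlip1.continuousOn.mono hsub).aestronglyMeasurable measurableSet_Ioc).aemeasurable
      have hm0 : AEStronglyMeasurable (fun r => g0 (xi r) (phi r) (psi r))
          (volume.restrict (Ioc 0 s1)) :=
        aesm_comp_aux (fun p : (EuclideanSpace ℝ (Fin n) × EuclideanSpace ℝ (Fin m)) ×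
          EuclideanSpace ℝ (Fin q) => g0 p.1.1 p.1.2 p.2) ((univ ×ˢ U) ×ˢ V)
          ((MeasurableSet.univ.prod hUc.measurableSet).prod hVc.measurableSet) hg0c
          (fun r => ((xi r, phi r), psi r)) _ measurableSet_Ioc
          ((hxm.aemeasurable.prodMk hphim).prodMk hpsim.aemeasurable)
          (fun r hr => ⟨⟨mem_univ _, (hrange r (hsub r hr)).2⟩, hpsiV r (hsub r hr)⟩)
      have hmi : ∀ i, AEStronglyMeasurable (fun r => g i (xi r) (phi r))
          (volume.restrict (Ioc 0 s1)) := fun i =>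
        aesm_comp_aux (fun p : EuclideanSpace ℝ (Fin n) × EuclideanSpace ℝ (Fin m) =>
          g i p.1 p.2) (univ ×ˢ U)
          (MeasurableSet.univ.prod hUc.measurableSet) (contOn_aux U (g i) (hgL i))
          (fun r => (xi r, phi r)) _ measurableSet_Ioc
          (hxm.aemeasurable.prodMk hphim)
          (fun r hr => ⟨mem_univ _, (hrange r (hsub r hr)).2⟩)
      refine AEStronglyMeasurable.add
        ((measurable_deriv phi0).aestronglyMeasurable.smul hm0) ?_
      refine Finset.aestronglyMeasurable_fun_sum _ fun i _ => ?_
      have h1 := measurable_deriv phi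
      have h2 : Measurable (fun r => (deriv phi r) i) := by fun_prop
      exact AEStronglyMeasurable.smul h2.aestronglyMeasurable (hmi i)
  intro t ht
  obtain ⟨hs0D, -, -⟩ := hclock t ht
  obtain ⟨s1, hs1D, hs01⟩ := hDup _ hs0D
  have hs10 : 0 ≤ s1 := by rw [hD] at hs1D; exact hs1D.1
  have hgood : ∀ᵐ s ∂(volume : Measure ℝ), s ∈ Ioo 0 s1 →
      DifferentiableAt ℝ phi0 s ∧ DifferentiableAt ℝ phi s ∧ HasDerivAt xi (F s) s := by
    filter_upwards [hlip0.ae_differentiableWithinAt_of_mem_real,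
      hlip1.ae_differentiableWithinAt_of_mem_real, (hint s1 hs1D).ae_hasDerivAt_integral]
      with s h1 h2 h3 hs
    have hsD := hDdown s1 hs1D s hs.1.le hs.2.le
    have hn := hDnhds s hsD hs.1
    refine ⟨(h1 hsD).differentiableAt hn, (h2 hsD).differentiableAt hn, ?_⟩
    have h4 := (h3 (by rw [uIcc_of_le hs10]; exact ⟨hs.1.le, hs.2.le⟩) 0 left_mem_uIcc).const_add
      x0bar
    refine h4.congr_of_eventuallyEq ?_
    filter_upwards [hn] with r hr using hxi' r hr
  set N : Set ℝ := {s | s ∈ Ioo 0 s1 ∧ ¬ (DifferentiableAt ℝ phi0 s ∧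
    DifferentiableAt ℝ phi s ∧ HasDerivAt xi (F s) s)} with hN
  have hN0 : volume N = 0 := by
    rw [ae_iff] at hgood
    refine measure_mono_null ?_ hgood
    exact fun s hs h => hs.2 (h hs.1)
  have hND : N ⊆ D := fun s hs => hDdown s1 hs1D s hs.1.1.le hs.1.2.le
  have hN1 : volume (phi0 '' N) = 0 := by
    have := (hlip0.mono hND).hausdorffMeasure_image_le (d := 1) zero_le_one
    rw [hausdorffMeasure_real, hN0] at this
    simpa using this
  have hQ0 : volume (phi0 '' (range ((↑) : ℚ → ℝ))) = 0 :=
    ((countable_range _).image _).measure_zero _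
  have hkey : ∀ᵐ τ ∂(volume : Measure ℝ), τ ∈ Ioo 0 t →
      deriv (fun t => xi (sig t)) τ =
      g0 (xi (sig τ)) (u τ) (v τ) + ∑ i, ((deriv u τ) i) • g i (xi (sig τ)) (u τ) := by
    filter_upwards [measure_eq_zero_iff_ae_notMem.mp hN1, measure_eq_zero_iff_ae_notMem.mp hQ0,
      hsigmono.ae_differentiableWithinAt_of_mem] with τ h1 h2 h3 hτ
    have hτT : τ ∈ Ico 0 T := ⟨hτ.1.le, hτ.2.trans ht.2⟩
    have hτn : Ico 0 T ∈ 𝓝 τ := Ico_mem_nhds hτ.1 hτT.2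
    have hsd : HasDerivAt sig (deriv sig τ) τ := ((h3 hτT).differentiableAt hτn).hasDerivAt
    obtain ⟨hsD, hp0, hp⟩ := hclock τ hτT
    have hspos : 0 < sig τ := by
      have : 0 ≤ sig τ := by rw [hD] at hsD; exact hsD.1
      refine lt_of_le_of_ne this fun h => ?_
      rw [← h, h00] at hp0
      exact hτ.1.ne hp0
    have hsIoo : sig τ ∈ Ioo 0 s1 :=
      ⟨hspos, (hsigmono hτT ht hτ.2.le).trans_lt hs01⟩
    have hgd : DifferentiableAt ℝ phi0 (sig τ) ∧
        DifferentiableAt ℝ phi (sig τ) ∧ HasDerivAt xi (F (sig τ)) (sig τ) := by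
      by_contra hcon
      exact h1 ⟨sig τ, ⟨hsIoo, hcon⟩, hp0⟩
    obtain ⟨d0, d1, d2⟩ := hgd
    -- the control `psi` matches `v`
    have hpsi : psi (sig τ) = v τ := by
      obtain ⟨s, hs, hs0, -, hsv⟩ := hgraph τ hτT
      have hss : s = sig τ := by
        by_contra hne
        have hcase : ∀ a ∈ D, ∀ b ∈ D, phi0 a = τ → phi0 b = τ → a < b → False := by
          intro a ha b hb hpa hpb hab
          obtain ⟨c, hc1, hc2⟩ := exists_rat_btwn hab
          have hcD : (c : ℝ) ∈ D :=
            hDdown b hb c ((by rw [hD] at ha; exact ha.1 : (0:ℝ) ≤ a).trans hc1.le) hc2.le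
          refine h2 ⟨c, ⟨c, rfl⟩, le_antisymm ?_ ?_⟩
          · rw [← hpb]; exact hmono hcD hb hc2.le
          · rw [← hpa]; exact hmono ha hcD hc1.le
        rcases lt_or_gt_of_ne hne with h | h
        · exact hcase _ hs _ hsD hs0 hp0 h
        · exact hcase _ hsD _ hs hp0 hs0 h
      rw [← hss, hsv]
    have c0 : deriv sig τ * deriv phi0 (sig τ) = 1 := by
      have e := (d0.hasDerivAt.scomp τ hsd)
      have e' : HasDerivAt (phi0 ∘ sig) 1 τ := by
        refine (hasDerivAt_id τ).congr_of_eventuallyEq ?_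
        filter_upwards [hτn] with r hr using (hclock r hr).2.1
      simpa using e.unique e'
    have c1 : deriv u τ = deriv sig τ • deriv phi (sig τ) := by
      have e := (d1.hasDerivAt.scomp τ hsd)
      refine HasDerivAt.deriv (e.congr_of_eventuallyEq ?_)
      filter_upwards [hτn] with r hr using (hclock r hr).2.2.symm
    have c2 : deriv (fun t => xi (sig t)) τ = deriv sig τ • F (sig τ) :=
      (d2.scomp τ hsd).deriv
    rw [c2, c1, hF]
    simp only [smul_add, Finset.smul_sum, smul_smul, c0, one_smul, hpsi, hp, PiLp.smul_apply,
      smul_eq_mul]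
  have hx := (hxAC t ht).2 t ⟨ht.1, le_rfl⟩
  simp only at hx
  have h0D : (0:ℝ) ∈ D := hDdown s1 hs1D 0 le_rfl hs10
  have hx0 : xi (sig 0) = x0bar := by
    rw [hsig0, hxi' 0 h0D]; simp
  rw [hx, hx0]
  congr 1
  refine intervalIntegral.integral_congr_ae ?_
  have hne : ∀ᵐ r ∂(volume : Measure ℝ), r ≠ t := by simp [ae_iff]
  filter_upwards [hkey, hne] with τ h1 h2 h3
  rw [uIoc_of_le ht.1] at h3
  exact h1 ⟨h3.1, lt_of_le_of_ne h3.2 h2⟩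

end
end

section
/- Assume the standing hypotheses on g₀, g₁, …, g_m and the compact sets U, V, and fix x̄₀, ū₀, T > 0. Let u : [0,T] → U with u(0)=ū₀ be absolutely continuous on [0,t] for every t < T, v : [0,T] → V measurable, and let (φ₀,φ,ψ,+∞) be a BV_loc graph completion of (u,v) with BV loops, i.e. such that the Lebesgue measure of {s ≥ 0 : φ₀'(s)=0} is finite. Let σ be a clock, let ξ be the space-time solution with initial datum x̄₀ corresponding to (φ₀,φ,ψ), assume ξ is bounded on [0,∞), set x := ξ∘σ on [0,T), assume x is absolutely continuous on [0,t] for every t < T, and suppose (x(T),u(T)) := lim_j (ξ(s_j),φ(s_j)) for some sequence s_j ↗ +∞. Then there exists a sequence τ_j ↗ T in [0,T) with (x(τ_j),u(τ_j)) → (x(T),u(T)); in particular x is an AC_loc solution, i.e. (x(T),u(T)) is a limit of values of (x,u) along times increasing to T. -/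
open MeasureTheory Set Filter Topology
open scoped ENNReal

noncomputable section

/-- Theorem 2.1 (ii) (Consistency) for graph completions with BV loops, `S = +∞`:
the extension of `x = ξ ∘ σ` by `(x(T),u(T)) := lim_j (ξ(s_j),φ(s_j))` is an AC_loc
solution, i.e. `(x(T),u(T))` is the limit of `(x,u)` along a sequence of times
increasing to `T`. -/
theorem stmt8 {n m q : ℕ}
    (U : Set (EuclideanSpace ℝ (Fin m))) (V : Set (EuclideanSpace ℝ (Fin q)))
    (g0 : EuclideanSpace ℝ (Fin n) → EuclideanSpace ℝ (Fin m) → EuclideanSpace ℝ (Fin q) →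
      EuclideanSpace ℝ (Fin n))
    (g : Fin m → EuclideanSpace ℝ (Fin n) → EuclideanSpace ℝ (Fin m) →
      EuclideanSpace ℝ (Fin n))
    (M : ℝ) (hst : StandingHyp U V g0 g M)
    (x0bar : EuclideanSpace ℝ (Fin n)) (u0bar : EuclideanSpace ℝ (Fin m))
    (T : ℝ) (hT : 0 < T)
    -- the control (u,v) : u ∈ AC_loc, v measurable
    (u : ℝ → EuclideanSpace ℝ (Fin m)) (hu0 : u 0 = u0bar)
    (huU : ∀ t ∈ Icc (0:ℝ) T, u t ∈ U) (huAC : ACloc u T)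
    (v : ℝ → EuclideanSpace ℝ (Fin q)) (hvmeas : Measurable v)
    (hvV : ∀ t ∈ Icc (0:ℝ) T, v t ∈ V)
    -- the BV_loc graph completion (φ₀,φ,ψ,+∞), with domain ℝ₊
    (phi0 : ℝ → ℝ) (phi : ℝ → EuclideanSpace ℝ (Fin m)) (psi : ℝ → EuclideanSpace ℝ (Fin q))
    (hlip : ∀ s1 ∈ Ici (0:ℝ), ∀ s2 ∈ Ici (0:ℝ),
      |phi0 s1 - phi0 s2| + ‖phi s1 - phi s2‖ ≤ |s1 - s2|)
    (hmono : MonotoneOn phi0 (Ici 0)) (h00 : phi0 0 = 0) (hphi0 : phi 0 = u0bar)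
    (hae : ∀ᵐ s ∂volume, s ∈ Ioi (0:ℝ) → deriv phi0 s + ‖deriv phi s‖ = 1)
    (hrange : ∀ s ∈ Ici (0:ℝ), phi0 s ∈ Icc (0:ℝ) T ∧ phi s ∈ U)
    (hpsim : Measurable psi) (hpsiV : ∀ s ∈ Ici (0:ℝ), psi s ∈ V)
    (hlim : Tendsto phi0 atTop (𝓝 T))
    (hgraph : ∀ t ∈ Ico (0:ℝ) T, ∃ s ∈ Ici (0:ℝ), phi0 s = t ∧ phi s = u t ∧ psi s = v t)
    -- BV loops: the set where φ₀' vanishes has finite measure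
    (hBVloops : volume {s : ℝ | 0 ≤ s ∧ deriv phi0 s = 0} < ⊤)
    -- the clock σ
    (sig : ℝ → ℝ) (hsig0 : sig 0 = 0) (hsigmono : MonotoneOn sig (Ico 0 T))
    (hclock : ∀ t ∈ Ico (0:ℝ) T, sig t ∈ Ici (0:ℝ) ∧ phi0 (sig t) = t ∧ phi (sig t) = u t)
    -- the space-time solution ξ, bounded on ℝ₊
    (xi : ℝ → EuclideanSpace ℝ (Fin n)) (hxi : IsSTSol g0 g x0bar phi0 phi psi xi (Ici 0))
    (hbdd : ∃ B : ℝ, ∀ s ∈ Ici (0:ℝ), ‖xi s‖ ≤ B)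
    -- x := ξ ∘ σ is AC_loc on [0,T)
    (hxAC : ACloc (fun t => xi (sig t)) T)
    -- (x(T),u(T)) := lim_j (ξ(s_j),φ(s_j)) along some s_j ↗ +∞
    (xT : EuclideanSpace ℝ (Fin n)) (uT : EuclideanSpace ℝ (Fin m)) (huT : u T = uT)
    (hsj : ∃ sj : ℕ → ℝ, StrictMono sj ∧ Tendsto sj atTop atTop ∧
      Tendsto (fun j => xi (sj j)) atTop (𝓝 xT) ∧
      Tendsto (fun j => phi (sj j)) atTop (𝓝 uT)) :
    -- conclusion: (x,u)(τ_j) → (x(T),u(T)) along some τ_j ↗ T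
    ∃ tau : ℕ → ℝ, StrictMono tau ∧ (∀ j, tau j ∈ Ico (0:ℝ) T) ∧
      Tendsto tau atTop (𝓝 T) ∧
      Tendsto (fun j => xi (sig (tau j))) atTop (𝓝 xT) ∧
      Tendsto (fun j => u (tau j)) atTop (𝓝 uT) := by
  obtain ⟨hUc, -, -, -, -, hM, hgrow⟩ := hst
  obtain ⟨B, hB⟩ := hbdd
  obtain ⟨R, hR⟩ := hUc.isBounded.exists_norm_le
  obtain ⟨sj, -, hsj, hsx, hsu⟩ := hsj
  have hd : ∀ r ∈ Ioi (0:ℝ), ‖deriv phi0 r‖ ≤ 1 ∧ ‖deriv phi r‖ ≤ 1 := by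
    intro r hr
    have hr' : (0:ℝ) < r := hr
    have hn : ∀ᶠ y in 𝓝 r, y ∈ Ici (0:ℝ) := by
      filter_upwards [Ioi_mem_nhds hr'] with y hy using Ioi_subset_Ici_self hy
    constructor
    · apply norm_deriv_le_of_lip' zero_le_one
      filter_upwards [hn] with y hy
      have := hlip y hy r hr'.le
      have h2 := norm_nonneg (phi y - phi r)
      rw [Real.norm_eq_abs, Real.norm_eq_abs]; linarith
    · apply norm_deriv_le_of_lip' zero_le_one
      filter_upwards [hn] with y hy
      have := hlip y hy r hr'.le
      have h2 := abs_nonneg (phi0 y - phi0 r)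
      rw [Real.norm_eq_abs]; linarith
  -- the integrand is bounded
  obtain ⟨f, hf⟩ : ∃ f : ℝ → EuclideanSpace ℝ (Fin n), f = fun r =>
    ((deriv phi0 r) • g0 (xi r) (phi r) (psi r) +
      ∑ i, ((deriv phi r) i) • g i (xi r) (phi r)) := ⟨_, rfl⟩
  have hxi' : ∀ s ∈ Ici (0:ℝ), xi s = x0bar + ∫ r in (0:ℝ)..s, f r := by
    rw [hf]; exact hxi
  obtain ⟨K, hK⟩ : ∃ K : ℝ, ∀ r ∈ Ioi (0:ℝ), ‖f r‖ ≤ K := by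
    refine ⟨(M * (1 + Real.sqrt (B ^ 2 + R ^ 2))) +
      ∑ _i : Fin m, (M * (1 + Real.sqrt (B ^ 2 + R ^ 2))), ?_⟩
    intro r hr
    have hr0 : r ∈ Ici (0:ℝ) := Ioi_subset_Ici_self hr
    obtain ⟨h1, h2⟩ := hd r hr
    have hb := hB r hr0
    have hu' := hR _ (hrange r hr0).2
    have hg := hgrow (xi r) (phi r) (hrange r hr0).2 (psi r) (hpsiV r hr0)
    have hle : M * (1 + Real.sqrt (‖xi r‖ ^ 2 + ‖phi r‖ ^ 2)) ≤
        M * (1 + Real.sqrt (B ^ 2 + R ^ 2)) := by gcongr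
    have hg' := hg.trans hle
    have hs : 0 ≤ ∑ i, ‖g i (xi r) (phi r)‖ ^ 2 := by positivity
    have e0 : ‖g0 (xi r) (phi r) (psi r)‖ ≤ M * (1 + Real.sqrt (B ^ 2 + R ^ 2)) := by
      refine le_trans (Real.le_sqrt_of_sq_le ?_) hg'
      linarith
    have ei : ∀ i, ‖g i (xi r) (phi r)‖ ≤ M * (1 + Real.sqrt (B ^ 2 + R ^ 2)) := by
      intro i
      refine le_trans (Real.le_sqrt_of_sq_le ?_) hg'
      have := Finset.single_le_sum (f := fun i => ‖g i (xi r) (phi r)‖ ^ 2)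
        (fun i _ => by positivity) (Finset.mem_univ i)
      have h3 := sq_nonneg ‖g0 (xi r) (phi r) (psi r)‖
      linarith
    rw [hf]
    refine (norm_add_le _ _).trans (add_le_add ?_ ((norm_sum_le _ _).trans
      (Finset.sum_le_sum fun i _ => ?_)))
    · rw [norm_smul]
      calc _ ≤ 1 * ‖g0 (xi r) (phi r) (psi r)‖ := by gcongr
        _ ≤ _ := by rw [one_mul]; exact e0
    · rw [norm_smul]
      have h3 : ‖(deriv phi r) i‖ ≤ 1 := (PiLp.norm_apply_le _ i).trans h2
      calc _ ≤ 1 * ‖g i (xi r) (phi r)‖ := by gcongr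
        _ ≤ _ := by rw [one_mul]; exact ei i
  -- xi is eventually Lipschitz
  obtain ⟨A, hA0, hA⟩ : ∃ A : ℝ, 0 ≤ A ∧ ∀ s, A ≤ s → ∀ s', A ≤ s' →
      ‖xi s - xi s'‖ ≤ |K| * |s - s'| := by
    by_cases hI : ∀ s, 0 ≤ s → IntervalIntegrable f volume 0 s
    · refine ⟨0, le_rfl, fun s hs s' hs' => ?_⟩
      rw [hxi' s hs, hxi' s' hs', add_sub_add_left_eq_sub,
        intervalIntegral.integral_interval_sub_left (hI s hs) (hI s' hs')]
      apply intervalIntegral.norm_integral_le_of_norm_le_const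
      intro r hr
      refine (hK r ?_).trans (le_abs_self K)
      rw [uIoc, mem_Ioc] at hr
      exact lt_of_le_of_lt (le_min hs' hs) hr.1
    · push Not at hI
      obtain ⟨a, ha, hna⟩ := hI
      refine ⟨a, ha, fun s hs s' hs' => ?_⟩
      have hz : ∀ s, a ≤ s → xi s = x0bar := by
        intro s hs
        rw [hxi' s (ha.trans hs), intervalIntegral.integral_undef, add_zero]
        intro hc
        apply hna
        apply hc.mono_set
        rw [uIcc_of_le ha, uIcc_of_le (ha.trans hs)]
        exact Icc_subset_Icc le_rfl hs
      rw [hz s hs, hz s' hs', sub_self, norm_zero]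
      positivity
  -- loops
  obtain ⟨Z, hZ⟩ : ∃ Z : Set ℝ, Z = {s : ℝ | 0 ≤ s ∧ deriv phi0 s = 0} := ⟨_, rfl⟩
  rw [← hZ] at hBVloops
  have hZm : MeasurableSet Z := by
    rw [hZ]
    exact measurableSet_Ici.inter (measurable_deriv phi0 (measurableSet_singleton 0))
  have hsub : ∀ a b, 0 ≤ a → phi0 a = phi0 b → Ioo a b ⊆ Z := by
    intro a b ha hab r hr
    have hc : ∀ y ∈ Ioo a b, phi0 y = phi0 a := by
      intro y hy
      have hy0 : 0 ≤ y := ha.trans hy.1.le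
      exact le_antisymm (hab ▸ hmono hy0 (hy0.trans hy.2.le) hy.2.le) (hmono ha hy0 hy.1.le)
    rw [hZ]
    refine ⟨ha.trans hr.1.le, ?_⟩
    have : phi0 =ᶠ[𝓝 r] fun _ => phi0 a := by
      filter_upwards [isOpen_Ioo.mem_nhds hr] with y hy using hc y hy
    rw [this.deriv_eq]; simp
  have hlen : ∀ a b, 0 ≤ a → phi0 a = phi0 b → ENNReal.ofReal (b - a) ≤ volume (Z ∩ Ici a) := by
    intro a b ha hab
    rw [← Real.volume_Ioo]
    exact measure_mono fun r hr => ⟨hsub a b ha hab hr, hr.1.le⟩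
  have htail : Tendsto (fun r : ℝ => volume (Z ∩ Ici r)) atTop (𝓝 0) := by
    have := tendsto_measure_iInter_atTop (μ := volume) (s := fun r : ℝ => Z ∩ Ici r)
      (fun r => (hZm.inter measurableSet_Ici).nullMeasurableSet)
      (fun a b hab => inter_subset_inter_right _ (Ici_subset_Ici.2 hab))
      ⟨0, ((measure_mono inter_subset_left).trans_lt hBVloops).ne⟩
    have he : (⋂ r : ℝ, Z ∩ Ici r) = ∅ := by
      ext y
      simp only [mem_iInter, mem_inter_iff, mem_Ici, mem_empty_iff_false, iff_false, not_forall]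
      exact ⟨y + 1, fun h => by linarith [h.2]⟩
    rw [he, measure_empty] at this
    exact this
  have hlt : ∀ s, 0 ≤ s → phi0 s < T := by
    intro s hs
    refine lt_of_le_of_ne (hrange s hs).1.2 fun h => ?_
    have hc : ∀ b, s ≤ b → phi0 s = phi0 b := fun b hb =>
      le_antisymm (hmono hs (hs.trans hb) hb) (h ▸ (hrange b (hs.trans hb)).1.2)
    have : Ioi s ⊆ Z := fun r hr =>
      hsub s (r + 1) hs (hc _ (by have : s < r := hr; linarith)) ⟨hr, by linarith⟩
    have h3 := (measure_mono (μ := volume) this).trans_lt hBVloops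
    rw [Real.volume_Ioi] at h3
    exact lt_irrefl _ h3
  obtain ⟨C, hC⟩ : ∃ C : ℝ, C = (volume Z).toReal := ⟨_, rfl⟩
  have hC0 : 0 ≤ C := hC ▸ ENNReal.toReal_nonneg
  have hlenC : ∀ a b, 0 ≤ a → phi0 a = phi0 b → b - a ≤ C := by
    intro a b ha hab
    rw [hC]
    refine (ENNReal.ofReal_le_iff_le_toReal hBVloops.ne).1 ?_
    exact (hlen a b ha hab).trans (measure_mono inter_subset_left)
  have hsjpos : ∀ᶠ j in atTop, 0 ≤ sj j := hsj.eventually_ge_atTop 0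
  have hprop : ∀ᶠ j in atTop, phi0 (sj j) ∈ Ico (0:ℝ) T ∧ sj j - C ≤ sig (phi0 (sj j)) ∧
      u (phi0 (sj j)) = phi (sig (phi0 (sj j))) ∧
      ENNReal.ofReal |sig (phi0 (sj j)) - sj j| ≤ volume (Z ∩ Ici (sj j - C)) := by
    filter_upwards [hsjpos] with j hj
    have hm : phi0 (sj j) ∈ Ico (0:ℝ) T := ⟨(hrange _ hj).1.1, hlt _ hj⟩
    obtain ⟨c1, c2, c3⟩ := hclock _ hm
    have c1' : 0 ≤ sig (phi0 (sj j)) := c1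
    have l1 := hlenC _ _ c1 c2
    refine ⟨hm, by linarith, c3.symm, ?_⟩
    rcases le_total (sj j) (sig (phi0 (sj j))) with h | h
    · rw [abs_of_nonneg (by linarith)]
      refine (hlen _ _ hj c2.symm).trans (measure_mono ?_)
      exact inter_subset_inter_right _ (Ici_subset_Ici.2 (by linarith))
    · rw [abs_of_nonpos (by linarith), neg_sub]
      refine (hlen _ _ c1 c2).trans (measure_mono ?_)
      exact inter_subset_inter_right _ (Ici_subset_Ici.2 (by linarith))
  have hsjC : Tendsto (fun j => sj j - C) atTop atTop := tendsto_atTop_add_const_right _ (-C) hsj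
  have hdist : Tendsto (fun j => |sig (phi0 (sj j)) - sj j|) atTop (𝓝 0) := by
    have h1 : Tendsto (fun j => ENNReal.ofReal |sig (phi0 (sj j)) - sj j|) atTop (𝓝 0) :=
      tendsto_of_tendsto_of_tendsto_of_le_of_le' tendsto_const_nhds (htail.comp hsjC)
        (Eventually.of_forall fun _ => zero_le) (hprop.mono fun j h => h.2.2.2)
    have h2 := (ENNReal.tendsto_toReal ENNReal.zero_ne_top).comp h1
    simpa [Function.comp_def] using h2
  have ht : Tendsto (fun j => phi0 (sj j)) atTop (𝓝 T) := hlim.comp hsj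
  have hX : Tendsto (fun j => xi (sig (phi0 (sj j)))) atTop (𝓝 xT) := by
    have h0 : Tendsto (fun j => xi (sig (phi0 (sj j))) - xi (sj j)) atTop (𝓝 0) := by
      apply squeeze_zero_norm' (a := fun j => |K| * |sig (phi0 (sj j)) - sj j|)
      · filter_upwards [hprop, hsjC.eventually_ge_atTop A] with j h h'
        exact hA _ (h'.trans h.2.1) _ (by linarith)
      · simpa using hdist.const_mul |K|
    simpa using h0.add hsx
  have hUt : Tendsto (fun j => u (phi0 (sj j))) atTop (𝓝 uT) := by
    have h0 : Tendsto (fun j => u (phi0 (sj j)) - phi (sj j)) atTop (𝓝 0) := by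
      apply squeeze_zero_norm' (a := fun j => |sig (phi0 (sj j)) - sj j|)
      · filter_upwards [hprop, hsjpos] with j h h'
        rw [h.2.2.1]
        have := hlip _ (hclock _ h.1).1 _ h'
        have h4 := abs_nonneg (phi0 (sig (phi0 (sj j))) - phi0 (sj j))
        linarith
      · exact hdist
    simpa using h0.add hsu
  -- shift so that everything holds for all indices
  obtain ⟨N, hN⟩ := eventually_atTop.1 hprop
  have hmem : ∀ k, phi0 (sj (k + N)) ∈ Ico (0:ℝ) T := fun k => (hN _ (Nat.le_add_left _ _)).1
  have hshift := tendsto_add_atTop_nat N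
  have ht' := ht.comp hshift
  have hinv : Tendsto (fun k => (T - phi0 (sj (k + N)))⁻¹) atTop atTop := by
    apply Tendsto.inv_tendsto_nhdsGT_zero
    apply tendsto_nhdsWithin_iff.2
    refine ⟨?_, Eventually.of_forall fun k => sub_pos.2 (hmem k).2⟩
    simpa [Function.comp_def] using ht'.const_sub T
  obtain ⟨e, he, hue⟩ := strictMono_subseq_of_tendsto_atTop hinv
  refine ⟨fun k => phi0 (sj (e k + N)), ?_, fun k => hmem _, ht'.comp he.tendsto_atTop,
    (hX.comp hshift).comp he.tendsto_atTop, (hUt.comp hshift).comp he.tendsto_atTop⟩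
  intro a b hab
  have h5 := hue hab
  simp only [Function.comp_apply] at h5
  have h6 := (inv_lt_inv₀ (sub_pos.2 (hmem (e a)).2) (sub_pos.2 (hmem (e b)).2)).1 h5
  show phi0 (sj (e a + N)) < phi0 (sj (e b + N))
  linarith

end
end

section
/- Assume the standing hypotheses on g₀, g₁, …, g_m and the compact sets U, V and fix x̄₀, ū₀, T > 0. Let 0 < S ≤ +∞ and let (φ₀,φ) : [0,S) → [0,T] × U be 1-Lipschitz with φ₀(0)=0, φ(0)=ū₀, φ₀'(s)+|φ'(s)| = 1 a.e., φ₀'(s) > 0 for a.e. s ∈ [0,S), and lim_{s→S} φ₀(s) = T; let ψ : [0,S) → V be Borel measurable and let ξ be the space-time solution with initial datum x̄₀ corresponding to (φ₀,φ,ψ). Then φ₀ is strictly increasing; define (u,v) := (φ,ψ)∘φ₀⁻¹ on [0,T) and let x be the Carathéodory solution corresponding to (u,v). Then u is absolutely continuous on [0,t] for every t < T, u(0)=ū₀, and (x(φ₀(s)),u(φ₀(s)),v(φ₀(s))) = (ξ(s),φ(s),ψ(s)) for every s ∈ [0,S). -/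
open MeasureTheory Set Filter Topology
open scoped ENNReal

noncomputable section

/-- `x` is a Carathéodory solution on `D` of the impulsive system, for an absolutely
continuous control `u` and a measurable control `v`, with initial datum `x0`. -/
def IsCaraSol {n m q : ℕ}
    (g0 : EuclideanSpace ℝ (Fin n) → EuclideanSpace ℝ (Fin m) → EuclideanSpace ℝ (Fin q) →
      EuclideanSpace ℝ (Fin n))
    (g : Fin m → EuclideanSpace ℝ (Fin n) → EuclideanSpace ℝ (Fin m) →
      EuclideanSpace ℝ (Fin n))
    (x0 : EuclideanSpace ℝ (Fin n)) (u : ℝ → EuclideanSpace ℝ (Fin m))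
    (v : ℝ → EuclideanSpace ℝ (Fin q)) (x : ℝ → EuclideanSpace ℝ (Fin n))
    (D : Set ℝ) : Prop :=
  ∀ t ∈ D, x t = x0 + ∫ r in (0:ℝ)..t,
    (g0 (x r) (u r) (v r) + ∑ i, ((deriv u r) i) • g i (x r) (u r))

/-- Fundamental theorem of calculus for Lipschitz maps into a Euclidean space. -/
lemma ftc_lip {m : ℕ} {f : ℝ → EuclideanSpace ℝ (Fin m)} {s : ℝ} (hs : 0 ≤ s)
    (hf : LipschitzOnWith 1 f (Icc 0 s)) :
    (∀ᵐ r ∂volume, r ∈ Icc (0:ℝ) s → DifferentiableAt ℝ f r) ∧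
    IntervalIntegrable (deriv f) volume 0 s ∧ ∫ r in (0:ℝ)..s, deriv f r = f s - f 0 := by
  have hac : ∀ i, AbsolutelyContinuousOnInterval (fun r => f r i) 0 s := by
    intro i
    apply LipschitzOnWith.absolutelyContinuousOnInterval (K := 1)
    rw [uIcc_of_le hs]
    refine LipschitzOnWith.of_dist_le_mul fun x hx y hy => ?_
    refine le_trans ?_ (hf.dist_le_mul x hx y hy)
    rw [dist_eq_norm, dist_eq_norm]
    exact PiLp.norm_apply_le (f x - f y) i
  have hd : ∀ᵐ r ∂volume, r ∈ Icc (0:ℝ) s → DifferentiableAt ℝ f r := by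
    have h1 : ∀ᵐ x : ℝ, x ≠ 0 := by simp [ae_iff, measure_singleton]
    have h2 : ∀ᵐ x : ℝ, x ≠ s := by simp [ae_iff, measure_singleton]
    filter_upwards [hf.ae_differentiableWithinAt_of_mem_real, h1, h2] with r hr a b hm
    exact (hr hm).differentiableAt
      (Icc_mem_nhds (lt_of_le_of_ne hm.1 a.symm) (lt_of_le_of_ne hm.2 b))
  have hco : ∀ i, ∀ᵐ r ∂(volume.restrict (Ioc 0 s)),
      deriv (fun r => f r i) r = deriv f r i := by
    intro i
    rw [ae_restrict_iff' measurableSet_Ioc]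
    filter_upwards [hd] with r hr hm
    have := (hr (Ioc_subset_Icc_self hm)).hasDerivAt
    exact ((EuclideanSpace.proj (𝕜 := ℝ) i).hasFDerivAt.comp_hasDerivAt r this).deriv
  have hint : ∀ i, IntegrableOn (fun r => deriv f r i) (Ioc 0 s) volume := by
    intro i
    have := (hac i).intervalIntegrable_deriv
    rw [intervalIntegrable_iff_integrableOn_Ioc_of_le hs] at this
    exact Integrable.congr this (hco i)
  refine ⟨hd, ?_, ?_⟩
  · rw [intervalIntegrable_iff_integrableOn_Ioc_of_le hs]
    exact Integrable.of_eval_piLp hint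
  · ext i
    rw [intervalIntegral.integral_of_le hs, eval_integral_piLp hint, ← integral_congr_ae (hco i),
      ← intervalIntegral.integral_of_le hs, (hac i).integral_deriv_eq_sub]
    simp

/-- A Lipschitz real function maps null sets to null sets. -/
lemma lip_null {f : ℝ → ℝ} {A : Set ℝ} (hf : LipschitzOnWith 1 f A) (hA : volume A = 0) :
    volume (f '' A) = 0 := by
  have h := hf.hausdorffMeasure_image_le (d := 1) zero_le_one
  rw [hausdorffMeasure_real, hA] at h
  simpa using h

/-- Change of variables for a strictly increasing Lipschitz function. -/
lemma cov {F : Type*} [NormedAddCommGroup F] [NormedSpace ℝ F] {p : ℝ → ℝ} {s : ℝ}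
    (hs : 0 ≤ s) (p0 : p 0 = 0) (hlip : LipschitzOnWith 1 p (Icc 0 s))
    (hmono : StrictMonoOn p (Icc 0 s))
    (hpos : ∀ᵐ r ∂volume, r ∈ Ioo (0:ℝ) s → 0 < deriv p r) (h k : ℝ → F)
    (hk : ∀ᵐ r ∂volume, r ∈ Ioo (0:ℝ) s → deriv p r • h (p r) = k r) :
    (∫ r in (0:ℝ)..(p s), h r = ∫ r in (0:ℝ)..s, k r) ∧
    (IntervalIntegrable k volume 0 s → IntervalIntegrable h volume 0 (p s)) := by
  have hps : 0 ≤ p s := by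
    rw [← p0]; exact hmono.monotoneOn (left_mem_Icc.2 hs) (right_mem_Icc.2 hs) hs
  obtain ⟨N, hN, hNm, hN0⟩ := exists_measurable_superset_of_null (ae_iff.1 (hpos.and hk))
  set A := Ioo 0 s \ N with hA
  have hAm : MeasurableSet A := measurableSet_Ioo.diff hNm
  have hgood : ∀ r ∈ A, 0 < deriv p r ∧ deriv p r • h (p r) = k r := by
    intro r hr
    by_contra hc
    exact hr.2 (hN fun hh => hc ⟨hh.1 hr.1, hh.2 hr.1⟩)
  have hAsub : A ⊆ Icc 0 s := sdiff_subset.trans Ioo_subset_Icc_self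
  have hder : ∀ r ∈ A, HasDerivWithinAt p (deriv p r) A r := fun r hr =>
    (differentiableAt_of_deriv_ne_zero (hgood r hr).1.ne').hasDerivAt.hasDerivWithinAt
  have hinj : InjOn p A := (hmono.mono hAsub).injOn
  have hAae : A =ᵐ[volume] Ioc 0 s :=
    (sdiff_null_ae_eq_self hN0).trans Ioo_ae_eq_Ioc
  have hcont : ContinuousOn p (Icc 0 s) := hlip.continuousOn
  have himg : p '' A =ᵐ[volume] Ioc 0 (p s) := by
    refine Filter.EventuallyEq.trans ?_ (Ioo_ae_eq_Ioc (a := 0) (b := p s))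
    have hsub : p '' A ⊆ Ioo 0 (p s) := by
      rintro _ ⟨r, hr, rfl⟩
      have := hr.1
      refine ⟨?_, hmono (hAsub hr) (right_mem_Icc.2 hs) this.2⟩
      rw [← p0]
      exact hmono (left_mem_Icc.2 hs) (hAsub hr) this.1
    refine (hsub.eventuallyLE).antisymm ?_
    rw [ae_le_set]
    have hnull : volume (p '' (Icc 0 s ∩ N)) = 0 :=
      lip_null (hlip.mono inter_subset_left) (measure_mono_null inter_subset_right hN0)
    refine measure_mono_null ?_ hnull
    rintro t ⟨ht, htA⟩
    have := intermediate_value_Icc hs hcont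
    rw [p0] at this
    obtain ⟨r, hr, rfl⟩ := this (Ioo_subset_Icc_self ht)
    refine ⟨r, ⟨hr, ?_⟩, rfl⟩
    by_contra hn
    refine htA ⟨r, ⟨⟨lt_of_le_of_ne hr.1 ?_, lt_of_le_of_ne hr.2 ?_⟩, hn⟩, rfl⟩
    · rintro rfl; rw [p0] at ht; exact lt_irrefl _ ht.1
    · rintro rfl; exact lt_irrefl _ ht.2
  have hEq : EqOn (fun r => |deriv p r| • h (p r)) k A := by
    intro r hr
    have := hgood r hr
    simp only [abs_of_pos this.1, this.2]
  constructor
  · rw [intervalIntegral.integral_of_le hps, intervalIntegral.integral_of_le hs,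
      ← setIntegral_congr_set himg, ← setIntegral_congr_set hAae,
      integral_image_eq_integral_abs_deriv_smul hAm hder hinj]
    exact setIntegral_congr_fun hAm hEq
  · rw [intervalIntegrable_iff_integrableOn_Ioc_of_le hs,
      intervalIntegrable_iff_integrableOn_Ioc_of_le hps]
    intro hki
    rw [← integrableOn_congr_set_ae himg,
      integrableOn_image_iff_integrableOn_abs_deriv_smul hAm hder hinj,
      integrableOn_congr_fun hEq hAm]
    exact (integrableOn_congr_set_ae hAae).2 hki

/-- Proposition 1.1 (ii): a feasible space-time trajectory-control pair with `φ₀' > 0`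
a.e. is the arc-length reparametrization of an AC_loc trajectory-control pair, namely
of `(x,u,v) := (ξ,φ,ψ) ∘ φ₀⁻¹`. -/
theorem stmt13 {n m q : ℕ}
    (U : Set (EuclideanSpace ℝ (Fin m))) (V : Set (EuclideanSpace ℝ (Fin q)))
    (g0 : EuclideanSpace ℝ (Fin n) → EuclideanSpace ℝ (Fin m) → EuclideanSpace ℝ (Fin q) →
      EuclideanSpace ℝ (Fin n))
    (g : Fin m → EuclideanSpace ℝ (Fin n) → EuclideanSpace ℝ (Fin m) →
      EuclideanSpace ℝ (Fin n))
    (M : ℝ) (hst : StandingHyp U V g0 g M)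
    (x0bar : EuclideanSpace ℝ (Fin n)) (u0bar : EuclideanSpace ℝ (Fin m))
    (T : ℝ) (hT : 0 < T)
    -- the feasible space-time control (φ₀,φ,ψ,S), with domain D = [0,S)
    (S : ℝ≥0∞) (hSpos : 0 < S)
    (D : Set ℝ) (hD : D = {s : ℝ | 0 ≤ s ∧ ENNReal.ofReal s < S})
    (phi0 : ℝ → ℝ) (phi : ℝ → EuclideanSpace ℝ (Fin m)) (psi : ℝ → EuclideanSpace ℝ (Fin q))
    (hlip : ∀ s1 ∈ D, ∀ s2 ∈ D, |phi0 s1 - phi0 s2| + ‖phi s1 - phi s2‖ ≤ |s1 - s2|)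
    (hmono : MonotoneOn phi0 D) (h00 : phi0 0 = 0) (hphi0 : phi 0 = u0bar)
    (hrange : ∀ s ∈ D, phi0 s ∈ Icc (0:ℝ) T ∧ phi s ∈ U)
    (hae : ∀ᵐ s ∂volume, s ∈ D → deriv phi0 s + ‖deriv phi s‖ = 1)
    -- φ₀' > 0 a.e.
    (haepos : ∀ᵐ s ∂volume, s ∈ D → 0 < deriv phi0 s)
    -- lim_{s→S} φ₀(s) = T
    (hlim : ∀ ε > (0:ℝ), ∃ s0 ∈ D, ∀ s ∈ D, s0 ≤ s → |phi0 s - T| < ε)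
    (hpsim : Measurable psi) (hpsiV : ∀ s ∈ D, psi s ∈ V)
    -- ξ : the corresponding space-time solution with initial datum x̄₀
    (xi : ℝ → EuclideanSpace ℝ (Fin n)) (hxi : IsSTSol g0 g x0bar phi0 phi psi xi D) :
    -- φ₀ is strictly increasing
    StrictMonoOn phi0 D ∧
    -- φ₀⁻¹ exists; (u,v) := (φ,ψ) ∘ φ₀⁻¹ is an AC_loc control with u(0) = ū₀, and the
    -- corresponding Carathéodory solution x satisfies (x,u,v) ∘ φ₀ = (ξ,φ,ψ)
    ∃ tau : ℝ → ℝ,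
      (∀ t ∈ Ico (0:ℝ) T, tau t ∈ D ∧ phi0 (tau t) = t) ∧
      (∀ s ∈ D, tau (phi0 s) = s) ∧
      phi (tau 0) = u0bar ∧
      ACloc (fun t => phi (tau t)) T ∧
      (∀ t ∈ Ico (0:ℝ) T, phi (tau t) ∈ U ∧ psi (tau t) ∈ V) ∧
      ∃ x : ℝ → EuclideanSpace ℝ (Fin n),
        IsCaraSol g0 g x0bar (fun t => phi (tau t)) (fun t => psi (tau t)) x (Ico 0 T) ∧
        ∀ s ∈ D, x (phi0 s) = xi s ∧ phi (tau (phi0 s)) = phi s ∧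
          psi (tau (phi0 s)) = psi s := by
  have h0D : (0:ℝ) ∈ D := by rw [hD]; exact ⟨le_rfl, by simpa using hSpos⟩
  have hDnn : ∀ s ∈ D, 0 ≤ s := by intro s hs; rw [hD] at hs; exact hs.1
  have hDdown : ∀ s ∈ D, ∀ r, 0 ≤ r → r ≤ s → r ∈ D := by
    intro s hs r h0 hr
    rw [hD] at hs ⊢
    exact ⟨h0, (ENNReal.ofReal_le_ofReal hr).trans_lt hs.2⟩
  have hDup : ∀ s ∈ D, ∃ s' ∈ D, s < s' := by
    intro s hs
    rw [hD] at hs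
    obtain ⟨c, hc1, hc2⟩ := exists_between hs.2
    have hcr : ENNReal.ofReal c.toReal = c := ENNReal.ofReal_toReal (ne_top_of_lt hc2)
    refine ⟨c.toReal, ?_, ?_⟩
    · rw [hD]; exact ⟨ENNReal.toReal_nonneg, by rwa [hcr]⟩
    · rw [← hcr] at hc1
      exact (ENNReal.ofReal_lt_ofReal_iff_of_nonneg hs.1).1 hc1
  have hDsub : ∀ s ∈ D, Icc 0 s ⊆ D := fun s hs r hr => hDdown s hs r hr.1 hr.2
  have hDnhds : ∀ s ∈ D, 0 < s → ∃ b ∈ D, 0 < s ∧ s < b := fun s hs h => by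
    obtain ⟨b, hb, hsb⟩ := hDup s hs
    exact ⟨b, hb, h, hsb⟩
  have hlip0 : LipschitzOnWith 1 phi0 D := by
    refine LipschitzOnWith.of_dist_le_mul fun x hx y hy => ?_
    rw [Real.dist_eq, Real.dist_eq, NNReal.coe_one, one_mul]
    linarith [hlip x hx y hy, norm_nonneg (phi x - phi y)]
  have hlip1 : LipschitzOnWith 1 phi D := by
    refine LipschitzOnWith.of_dist_le_mul fun x hx y hy => ?_
    rw [dist_eq_norm, Real.dist_eq, NNReal.coe_one, one_mul]
    linarith [hlip x hx y hy, abs_nonneg (phi0 x - phi0 y)]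
  have hstrict : StrictMonoOn phi0 D := by
    intro a ha b hb hab
    refine lt_of_le_of_ne (hmono ha hb hab.le) fun heq => ?_
    have hbad : ∀ᵐ s ∂volume, s ∉ Ioo a b := by
      filter_upwards [haepos] with s hs hm
      have hsD : s ∈ D := hDdown b hb s ((hDnn a ha).trans hm.1.le) hm.2.le
      have hz : phi0 =ᶠ[𝓝 s] fun _ => phi0 a := by
        filter_upwards [Ioo_mem_nhds hm.1 hm.2] with r hr
        have hrD : r ∈ D := hDdown b hb r ((hDnn a ha).trans hr.1.le) hr.2.le
        have h1 := hmono ha hrD hr.1.le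
        have h2 := hmono hrD hb hr.2.le
        exact le_antisymm (heq ▸ h2) h1
      have := hs hsD
      rw [hz.deriv_eq] at this
      simp at this
    have h0 := ae_iff.1 hbad
    simp only [not_not, ofPred_mem_eq, Real.volume_Ioo] at h0
    rw [ENNReal.ofReal_eq_zero] at h0
    linarith
  refine ⟨hstrict, ?_⟩
  have hltT : ∀ s ∈ D, phi0 s < T := by
    intro s hs
    obtain ⟨s', hs', hss⟩ := hDup s hs
    exact (hstrict hs hs' hss).trans_le (hrange s' hs').1.2
  have hico : ∀ s ∈ D, phi0 s ∈ Ico 0 T := fun s hs => ⟨(hrange s hs).1.1, hltT s hs⟩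
  have hsurj : ∀ t ∈ Ico (0:ℝ) T, ∃ s ∈ D, phi0 s = t := by
    intro t ht
    obtain ⟨s0, hs0, hs⟩ := hlim (T - t) (by linarith [ht.2])
    have h1 := (abs_lt.1 (hs s0 hs0 le_rfl)).1
    have hc : ContinuousOn phi0 (Icc 0 s0) := hlip0.continuousOn.mono (hDsub s0 hs0)
    have := intermediate_value_Icc (hDnn s0 hs0) hc
    rw [h00] at this
    obtain ⟨r, hr, hrt⟩ := this ⟨ht.1, by linarith⟩
    exact ⟨r, hDsub s0 hs0 hr, hrt⟩
  obtain ⟨tau, htau⟩ : ∃ tau : ℝ → ℝ, ∀ t ∈ Ico (0:ℝ) T, tau t ∈ D ∧ phi0 (tau t) = t := by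
    choose! f hf using hsurj
    exact ⟨f, hf⟩
  have hleft : ∀ s ∈ D, tau (phi0 s) = s := fun s hs =>
    hstrict.injOn (htau _ (hico s hs)).1 hs (htau _ (hico s hs)).2
  have htau0 : tau 0 = 0 := by simpa [h00] using hleft 0 h0D
  have htmono : StrictMonoOn tau (Ico 0 T) := by
    intro a ha b hb hab
    by_contra hc
    have := hmono (htau b hb).1 (htau a ha).1 (not_lt.1 hc)
    rw [(htau a ha).2, (htau b hb).2] at this
    linarith
  have htcont : ∀ s ∈ D, 0 < s → ContinuousAt tau (phi0 s) ∧ phi0 s ∈ Ioo 0 T := by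
    intro s hs h
    have hmem : ∀ r ∈ D, 0 < r → phi0 r ∈ Ioo 0 T := fun r hr h =>
      ⟨by rw [← h00]; exact hstrict h0D hr h, hltT r hr⟩
    refine ⟨?_, hmem s hs h⟩
    refine (htmono.mono Ioo_subset_Ico_self).continuousAt_of_image_mem_nhds
      (Ioo_mem_nhds (hmem s hs h).1 (hmem s hs h).2) ?_
    rw [hleft s hs]
    obtain ⟨b, hb, hsb⟩ := hDup s hs
    refine mem_of_superset (Ioo_mem_nhds h hsb) fun r hr => ?_
    have hrD := hDdown b hb r hr.1.le hr.2.le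
    exact ⟨phi0 r, hmem r hrD hr.1, hleft r hrD⟩
  have hderu : ∀ s ∈ D, 0 < s → 0 < deriv phi0 s → DifferentiableAt ℝ phi s →
      deriv phi0 s • deriv (fun t => phi (tau t)) (phi0 s) = deriv phi s := by
    intro s hs h hp hd
    obtain ⟨hc, hm⟩ := htcont s hs h
    have h1 : HasDerivAt phi0 (deriv phi0 s) (tau (phi0 s)) := by
      rw [hleft s hs]; exact (differentiableAt_of_deriv_ne_zero hp.ne').hasDerivAt
    have h2 : HasDerivAt tau (deriv phi0 s)⁻¹ (phi0 s) := by
      refine h1.of_local_left_inverse hc hp.ne' ?_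
      filter_upwards [Ioo_mem_nhds hm.1 hm.2] with t ht
      exact (htau t (Ioo_subset_Ico_self ht)).2
    have h3 : HasDerivAt phi (deriv phi s) (tau (phi0 s)) := by
      rw [hleft s hs]; exact hd.hasDerivAt
    have h4 : HasDerivAt (fun t => phi (tau t)) ((deriv phi0 s)⁻¹ • deriv phi s) (phi0 s) :=
      h3.scomp (phi0 s) h2
    rw [h4.deriv, smul_inv_smul₀ hp.ne']
  have hae2 : ∀ s ∈ D, ∀ᵐ r ∂volume, r ∈ Ioo (0:ℝ) s → 0 < deriv phi0 r ∧
      deriv phi0 r • deriv (fun t => phi (tau t)) (phi0 r) = deriv phi r := by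
    intro s hs
    filter_upwards [haepos, (ftc_lip (hDnn s hs) (hlip1.mono (hDsub s hs))).1] with r h1 h2 hr
    have hrD := hDsub s hs (Ioo_subset_Icc_self hr)
    exact ⟨h1 hrD, hderu r hrD hr.1 (h1 hrD) (h2 (Ioo_subset_Icc_self hr))⟩
  have hU : ∀ s ∈ D, IntervalIntegrable (deriv fun t => phi (tau t)) volume 0 (phi0 s) ∧
      ∫ r in (0:ℝ)..(phi0 s), deriv (fun t => phi (tau t)) r = phi s - phi 0 := by
    intro s hs
    obtain ⟨-, hi, hv⟩ := ftc_lip (hDnn s hs) (hlip1.mono (hDsub s hs))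
    obtain ⟨c1, c2⟩ := cov (hDnn s hs) h00 (hlip0.mono (hDsub s hs)) (hstrict.mono (hDsub s hs))
      ((hae2 s hs).mono fun r h hr => (h hr).1) (deriv fun t => phi (tau t)) (deriv phi)
      ((hae2 s hs).mono fun r h hr => (h hr).2)
    exact ⟨c2 hi, c1.trans hv⟩
  refine ⟨tau, htau, hleft, by rw [htau0, hphi0], ?_, fun t ht =>
    ⟨(hrange _ (htau t ht).1).2, hpsiV _ (htau t ht).1⟩, fun t => xi (tau t), ?_, fun s hs => by
      simp only [hleft s hs, and_self]⟩
  · intro t ht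
    have key : ∀ t ∈ Ico (0:ℝ) T, IntervalIntegrable (deriv fun t => phi (tau t)) volume 0 t ∧
        ∫ r in (0:ℝ)..t, deriv (fun t => phi (tau t)) r = phi (tau t) - phi 0 := by
      intro t ht
      have := hU _ (htau t ht).1
      rwa [(htau t ht).2] at this
    refine ⟨(key t ht).1, fun τ hτ => ?_⟩
    rw [(key τ ⟨hτ.1, hτ.2.trans_lt ht.2⟩).2]
    simp only [htau0]
    abel
  · intro t ht
    obtain ⟨hs, hst'⟩ := htau t ht
    refine (hxi _ hs).trans ?_
    generalize tau t = s at hs hst'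
    congr 1
    rw [← hst']
    refine (cov (hDnn s hs) h00 (hlip0.mono (hDsub s hs)) (hstrict.mono (hDsub s hs))
      ((hae2 s hs).mono fun r h hr => (h hr).1) _ _ ?_).1.symm
    filter_upwards [hae2 s hs] with r h hr
    obtain ⟨-, h2⟩ := h hr
    have hrD := hDsub s hs (Ioo_subset_Icc_self hr)
    simp only [hleft r hrD]
    rw [← h2, smul_add, Finset.smul_sum]
    simp only [PiLp.smul_apply, smul_eq_mul, mul_smul]

end
end

section
/- Assume the standing hypotheses on g₀, g₁, …, g_m and the compact sets U, V, and fix x̄₀ ∈ ℝ^n. Let 0 < S, S̃ ≤ +∞, let (φ̃₀,φ̃) : [0,S̃) → ℝ₊ × U be Lipschitz with φ̃₀ nondecreasing and φ̃₀(0)=0, let ψ̃ : [0,S̃) → V be Borel measurable, and let ξ̃ be the space-time solution with initial datum x̄₀ corresponding to (φ̃₀,φ̃,ψ̃). Let s̃ : [0,S) → [0,S̃) be a nondecreasing, surjective, Lipschitz map, and set (φ₀,φ,ψ) := (φ̃₀,φ̃,ψ̃)∘s̃. Then the space-time solution ξ with initial datum x̄₀ corresponding to (φ₀,φ,ψ)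 satisfies ξ(s) = ξ̃(s̃(s)) for every s ∈ [0,S). -/
open MeasureTheory Set Filter Topology
open scoped ENNReal NNReal

noncomputable section

lemma aux_gronwall {w : ℝ → ℝ} {a k T : ℝ} (hk : 0 ≤ k)
    (hw : ContinuousOn w (Icc 0 T)) (hw0 : ∀ s ∈ Icc 0 T, 0 ≤ w s)
    (h : ∀ s ∈ Icc 0 T, w s ≤ a + k * ∫ r in (0:ℝ)..s, w r) :
    ∀ s ∈ Icc 0 T, w s ≤ a + k * gronwallBound 0 k a s := by
  intro s hs
  have hT : (0:ℝ) ≤ T := hs.1.trans hs.2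
  have hint : IntervalIntegrable w volume 0 T :=
    ContinuousOn.intervalIntegrable (by rwa [uIcc_of_le hT])
  have hsub : ∀ t ∈ Icc 0 T, IntervalIntegrable w volume 0 t := fun t ht =>
    hint.mono_set (by rw [uIcc_of_le hT, uIcc_of_le ht.1]; exact Icc_subset_Icc le_rfl ht.2)
  have hnn : ∀ t ∈ Icc 0 T, 0 ≤ ∫ r in (0:ℝ)..t, w r := fun t ht =>
    intervalIntegral.integral_nonneg ht.1 fun r hr => hw0 r ⟨hr.1, hr.2.trans ht.2⟩
  have key := norm_le_gronwallBound_of_norm_deriv_right_le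
    (f := fun t => ∫ r in (0:ℝ)..t, w r) (f' := w) (δ := 0) (K := k) (ε := a) (a := 0) (b := T)
    (by
      have := intervalIntegral.continuousOn_primitive_interval' hint left_mem_uIcc
      rwa [uIcc_of_le hT] at this)
    (by
      intro x hx
      have hx' : Icc 0 T ∈ 𝓝[>] x :=
        mem_of_superset (Ioo_mem_nhdsGT hx.2) fun y hy => ⟨hx.1.trans hy.1.le, hy.2.le⟩
      refine intervalIntegral.integral_hasDerivWithinAt_right (t := Ioi x)
        (hsub x ⟨hx.1, hx.2.le⟩) ?_ ?_
      · exact ⟨Icc 0 T, hx', hw.aestronglyMeasurable measurableSet_Icc⟩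
      · exact (hw x ⟨hx.1, hx.2.le⟩).mono_of_mem_nhdsWithin hx')
    (by simp)
    (by
      intro x hx
      have hx' : x ∈ Icc 0 T := ⟨hx.1, hx.2.le⟩
      rw [Real.norm_of_nonneg (hw0 x hx'), Real.norm_of_nonneg (hnn x hx')]
      linarith [h x hx'])
    s hs
  rw [Real.norm_of_nonneg (hnn s hs), sub_zero] at key
  have := h s hs
  have := mul_le_mul_of_nonneg_left key hk
  linarith

/-- A priori estimate and integrability for solutions of a Caratheodory integral equation. -/
lemma aux_apriori {E : Type*} [NormedAddCommGroup E] [NormedSpace ℝ E] [CompleteSpace E]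
    {F : ℝ → E → E} {C T : ℝ} (hC : 0 ≤ C) (hT : 0 ≤ T)
    (hmeas : ∀ x : ℝ → E, AEStronglyMeasurable x (volume.restrict (Ioc 0 T)) →
      AEStronglyMeasurable (fun r => F r (x r)) (volume.restrict (Ioc 0 T)))
    (hgrow : ∀ r ∈ Ioo 0 T, ∀ x, ‖F r x‖ ≤ C * (1 + ‖x‖))
    {x0 : E} {x : ℝ → E} (hx : ∀ s ∈ Icc 0 T, x s = x0 + ∫ r in (0:ℝ)..s, F r (x r)) :
    IntervalIntegrable (fun r => F r (x r)) volume 0 T ∧ ContinuousOn x (Icc 0 T) := by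
  have hcont : ∀ s ∈ Icc 0 T, IntervalIntegrable (fun r => F r (x r)) volume 0 s →
      ContinuousOn x (Icc 0 s) := by
    intro s hs hi
    have := intervalIntegral.continuousOn_primitive_interval' hi left_mem_uIcc
    rw [uIcc_of_le hs.1] at this
    exact (continuousOn_const.add this).congr fun t ht => hx t ⟨ht.1, ht.2.trans hs.2⟩
  set a := ‖x0‖ + C * T with ha
  have ha0 : 0 ≤ a := by positivity
  set B := a + C * gronwallBound 0 C a T with hB
  have hbound : ∀ s ∈ Icc 0 T, IntervalIntegrable (fun r => F r (x r)) volume 0 s →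
      ‖x s‖ ≤ B := by
    intro s hs hi
    have hc := hcont s hs hi
    have key := aux_gronwall (w := fun t => ‖x t‖) (a := a) hC hc.norm
      (fun _ _ => norm_nonneg _) (by
        intro t ht
        have htT : t ∈ Icc 0 T := ⟨ht.1, ht.2.trans hs.2⟩
        have hct : ContinuousOn x (Icc 0 t) := hc.mono (Icc_subset_Icc le_rfl ht.2)
        have hwi : IntervalIntegrable (fun r => ‖x r‖) volume 0 t :=
          ContinuousOn.intervalIntegrable (by rw [uIcc_of_le ht.1]; exact hct.norm)
        have h1 : ‖∫ r in (0:ℝ)..t, F r (x r)‖ ≤ ∫ r in (0:ℝ)..t, C * (1 + ‖x r‖) := by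
          refine intervalIntegral.norm_integral_le_of_norm_le ht.1 ?_
            ((intervalIntegrable_const.add hwi).const_mul C)
          have hne : ∀ᵐ r : ℝ, r ≠ t := by simp [ae_iff]
          filter_upwards [hne] with r hr hrt
          exact hgrow r ⟨hrt.1, (lt_of_le_of_ne hrt.2 hr).trans_le htT.2⟩ _
        have h2 : ∫ r in (0:ℝ)..t, C * (1 + ‖x r‖) = C * (t + ∫ r in (0:ℝ)..t, ‖x r‖) := by
          rw [intervalIntegral.integral_const_mul,
            intervalIntegral.integral_add intervalIntegrable_const hwi]
          simp
        have h3 := norm_add_le x0 (∫ r in (0:ℝ)..t, F r (x r))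
        have h4 : C * t ≤ C * T := mul_le_mul_of_nonneg_left htT.2 hC
        show ‖x t‖ ≤ _
        rw [hx t htT]
        rw [h2] at h1
        rw [ha]
        linarith) s ⟨hs.1, le_rfl⟩
    have hm : gronwallBound 0 C a s ≤ gronwallBound 0 C a T :=
      gronwallBound_mono le_rfl ha0 hC hs.2
    have := mul_le_mul_of_nonneg_left hm hC
    rw [hB]
    linarith
  have hB' : ∀ s ∈ Icc 0 T, ‖x s‖ ≤ max B ‖x0‖ := by
    intro s hs
    by_cases hi : IntervalIntegrable (fun r => F r (x r)) volume 0 s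
    · exact (hbound s hs hi).trans (le_max_left _ _)
    · rw [hx s hs, intervalIntegral.integral_undef hi, add_zero]
      exact le_max_right _ _
  -- measurability
  set A := {s | s ∈ Icc 0 T ∧ IntervalIntegrable (fun r => F r (x r)) volume 0 s} with hA
  have h0A : (0:ℝ) ∈ A := ⟨⟨le_rfl, hT⟩, by simp⟩
  have hAb : BddAbove A := ⟨T, fun s hs => hs.1.2⟩
  set c := sSup A with hc
  have hc0 : 0 ≤ c := le_csSup hAb h0A
  have hcT : c ≤ T := csSup_le ⟨0, h0A⟩ fun s hs => hs.1.2
  have hco : ContinuousOn x (Ioo 0 c) := by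
    intro s hs
    obtain ⟨s', hs', hlt⟩ := exists_lt_of_lt_csSup ⟨0, h0A⟩ hs.2
    exact ((hcont s' hs'.1 hs'.2).continuousAt (Icc_mem_nhds hs.1 hlt)).continuousWithinAt
  have hm1 : AEStronglyMeasurable x (volume.restrict (Ioo 0 c)) :=
    hco.aestronglyMeasurable measurableSet_Ioo
  have hm1' : AEStronglyMeasurable x (volume.restrict (Ioc 0 c)) := by
    rwa [← Measure.restrict_congr_set Ioo_ae_eq_Ioc]
  have hm2 : AEStronglyMeasurable x (volume.restrict (Ioc c T)) := by
    refine (aestronglyMeasurable_const (b := x0)).congr ?_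
    refine (ae_restrict_iff' measurableSet_Ioc).2 (Eventually.of_forall fun s hs => ?_)
    have hsT : s ∈ Icc 0 T := ⟨hc0.trans hs.1.le, hs.2⟩
    have hi : ¬ IntervalIntegrable (fun r => F r (x r)) volume 0 s := fun hi =>
      absurd (le_csSup hAb (show s ∈ A from ⟨hsT, hi⟩)) (not_le.2 hs.1)
    rw [hx s hsT, intervalIntegral.integral_undef hi, add_zero]
  have hm : AEStronglyMeasurable x (volume.restrict (Ioc 0 T)) := by
    rw [← Ioc_union_Ioc_eq_Ioc hc0 hcT]
    exact aestronglyMeasurable_union_iff.2 ⟨hm1', hm2⟩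
  have hfin : IntervalIntegrable (fun r => F r (x r)) volume 0 T := by
    rw [intervalIntegrable_iff_integrableOn_Ioc_of_le hT]
    refine Integrable.of_bound (hmeas x hm) (C * (1 + max B ‖x0‖)) ?_
    have : ∀ᵐ r ∂(volume.restrict (Ioo (0:ℝ) T)), ‖F r (x r)‖ ≤ C * (1 + max B ‖x0‖) := by
      refine (ae_restrict_iff' measurableSet_Ioo).2 (Eventually.of_forall fun r hr => ?_)
      refine (hgrow r hr _).trans (mul_le_mul_of_nonneg_left ?_ hC)
      linarith [hB' r ⟨hr.1.le, hr.2.le⟩]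
    rwa [Measure.restrict_congr_set Ioo_ae_eq_Ioc] at this
  exact ⟨hfin, hcont T ⟨hT, le_rfl⟩ hfin⟩

lemma aux_unique {E : Type*} [NormedAddCommGroup E] [NormedSpace ℝ E] [CompleteSpace E]
    {F : ℝ → E → E} {C T : ℝ} (hC : 0 ≤ C) (hT : 0 ≤ T)
    (hmeas : ∀ x : ℝ → E, AEStronglyMeasurable x (volume.restrict (Ioc 0 T)) →
      AEStronglyMeasurable (fun r => F r (x r)) (volume.restrict (Ioc 0 T)))
    (hgrow : ∀ r ∈ Ioo 0 T, ∀ x, ‖F r x‖ ≤ C * (1 + ‖x‖))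
    (hlip : ∀ R > 0, ∃ L ≥ 0, ∀ r ∈ Ioo 0 T, ∀ x y, ‖x‖ ≤ R → ‖y‖ ≤ R →
      ‖F r x - F r y‖ ≤ L * ‖x - y‖)
    {x0 : E} {x y : ℝ → E} (hx : ∀ s ∈ Icc 0 T, x s = x0 + ∫ r in (0:ℝ)..s, F r (x r))
    (hy : ∀ s ∈ Icc 0 T, y s = x0 + ∫ r in (0:ℝ)..s, F r (y r)) : x T = y T := by
  obtain ⟨hix, hcx⟩ := aux_apriori hC hT hmeas hgrow hx
  obtain ⟨hiy, hcy⟩ := aux_apriori hC hT hmeas hgrow hy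
  obtain ⟨R1, hR1⟩ := isCompact_Icc.exists_bound_of_continuousOn hcx
  obtain ⟨R2, hR2⟩ := isCompact_Icc.exists_bound_of_continuousOn hcy
  obtain ⟨L, hL, hlip⟩ := hlip (max (max R1 R2) 1) (by positivity)
  have key := aux_gronwall (w := fun t => ‖x t - y t‖) (a := 0) (T := T) hL (hcx.sub hcy).norm
    (fun _ _ => norm_nonneg _) (by
      intro t ht
      have hsub : uIcc 0 t ⊆ uIcc 0 T := by
        rw [uIcc_of_le hT, uIcc_of_le ht.1]; exact Icc_subset_Icc le_rfl ht.2
      have hw : ContinuousOn (fun r => ‖x r - y r‖) (uIcc 0 t) :=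
        (hcx.sub hcy).norm.mono (by rw [uIcc_of_le ht.1]; exact Icc_subset_Icc le_rfl ht.2)
      show ‖x t - y t‖ ≤ _
      rw [hx t ht, hy t ht, add_sub_add_left_eq_sub,
        ← intervalIntegral.integral_sub (hix.mono_set hsub) (hiy.mono_set hsub), zero_add,
        ← intervalIntegral.integral_const_mul]
      refine intervalIntegral.norm_integral_le_of_norm_le ht.1 ?_
        (hw.intervalIntegrable.const_mul L)
      have hne : ∀ᵐ r : ℝ, r ≠ t := by simp [ae_iff]
      filter_upwards [hne] with r hr hrt
      have hr' : r ∈ Ioo 0 T := ⟨hrt.1, (lt_of_le_of_ne hrt.2 hr).trans_le ht.2⟩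
      have hr'' : r ∈ Icc 0 T := ⟨hr'.1.le, hr'.2.le⟩
      exact hlip r hr' _ _
        ((hR1 r hr'').trans ((le_max_left _ _).trans (le_max_left _ _)))
        ((hR2 r hr'').trans ((le_max_right _ _).trans (le_max_left _ _)))) T ⟨hT, le_rfl⟩
  rw [gronwallBound_ε0_δ0] at key
  simp only [mul_zero, add_zero, norm_le_zero_iff] at key
  exact sub_eq_zero.1 key

lemma aux_chain {E : Type*} [NormedAddCommGroup E] [NormedSpace ℝ E]
    {f : ℝ → E} {st : ℝ → ℝ} {r : ℝ} {D Dt : Set ℝ} {K : ℝ≥0} (hD : D ∈ 𝓝 r)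
    (hmaps : MapsTo st D Dt) (hf : LipschitzOnWith K f Dt) (hst : DifferentiableAt ℝ st r)
    (h : DifferentiableAt ℝ f (st r) ∨ deriv st r = 0) :
    deriv (fun s => f (st s)) r = deriv st r • deriv f (st r) := by
  rcases h with h | h
  · exact (h.hasDerivAt.scomp r hst.hasDerivAt).deriv
  · rw [h, zero_smul]
    have h1 : HasDerivAt st 0 r := h ▸ hst.hasDerivAt
    refine HasDerivAt.deriv ?_
    rw [hasDerivAt_iff_isLittleO] at h1 ⊢
    simp only [smul_zero, sub_zero] at h1 ⊢
    refine Asymptotics.IsBigO.trans_isLittleO (Asymptotics.IsBigO.of_bound K ?_) h1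
    filter_upwards [hD] with s hs
    exact hf.norm_sub_le (hmaps hs) (hmaps (mem_of_mem_nhds hD))

lemma aux_diff_ae {E : Type*} [NormedAddCommGroup E] [NormedSpace ℝ E] [FiniteDimensional ℝ E]
    {f : ℝ → E} {T : ℝ} {K : ℝ≥0}
    (hl : LipschitzOnWith K f (Icc 0 T)) :
    ∀ᵐ r : ℝ, r ∈ Ioo 0 T → DifferentiableAt ℝ f r := by
  filter_upwards [hl.ae_differentiableWithinAt_of_mem_real] with r hr hrT
  exact (hr ⟨hrT.1.le, hrT.2.le⟩).differentiableAt (Icc_mem_nhds hrT.1 hrT.2)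

lemma aux_null {st : ℝ → ℝ} {T : ℝ} {K : ℝ≥0} (hl : LipschitzOnWith K st (Icc 0 T))
    (hm : MonotoneOn st (Icc 0 T)) {N : Set ℝ} (hN : MeasurableSet N) (hN0 : volume N = 0) :
    ∀ᵐ r : ℝ, r ∈ Ioo 0 T → (DifferentiableAt ℝ st r ∧ (st r ∈ N → deriv st r = 0)) := by
  set A := Ioo 0 T ∩ {r | DifferentiableAt ℝ st r} with hA
  have hAm : MeasurableSet A := measurableSet_Ioo.inter (measurableSet_of_differentiableAt ℝ st)
  have hAs : A ⊆ Icc 0 T := fun r hr => ⟨hr.1.1.le, hr.1.2.le⟩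
  have key := lintegral_image_eq_lintegral_deriv_mul_of_monotoneOn (f := st) (f' := deriv st) hAm
    (fun r hr => hr.2.hasDerivAt.hasDerivWithinAt) (hm.mono hAs) (N.indicator 1)
  have h0 : ∫⁻ x in st '' A, N.indicator (1 : ℝ → ℝ≥0∞) x = 0 := by
    refine le_antisymm ?_ zero_le
    calc _ ≤ ∫⁻ x, N.indicator (1 : ℝ → ℝ≥0∞) x := setLIntegral_le_lintegral _ _
      _ = 0 := by rw [lintegral_indicator_one hN, hN0]
  rw [h0] at key
  have hsm : AEMeasurable st (volume.restrict A) :=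
    (hl.continuousOn.mono hAs).aemeasurable hAm
  have hi : Measurable (N.indicator (1 : ℝ → ℝ≥0∞)) := measurable_one.indicator hN
  have hz := (lintegral_eq_zero_iff'
    (((measurable_deriv st).ennreal_ofReal.aemeasurable).mul
      (hi.comp_aemeasurable hsm))).1 key.symm
  have hz' := (ae_restrict_iff' hAm).1 hz
  filter_upwards [hz', aux_diff_ae hl] with r h1 h2 hr
  refine ⟨h2 hr, fun hrN => ?_⟩
  have h3 := h1 ⟨hr, h2 hr⟩
  simp only [Pi.mul_apply, Function.comp_apply, Pi.zero_apply, indicator_of_mem hrN, Pi.one_apply,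
    mul_one, ENNReal.ofReal_eq_zero] at h3
  refine le_antisymm h3 ?_
  rw [← derivWithin_of_mem_nhds (Icc_mem_nhds hr.1 hr.2)]
  exact hm.derivWithin_nonneg

lemma aux_image_null {st : ℝ → ℝ} {s : Set ℝ} {K : ℝ≥0} (hl : LipschitzOnWith K st s)
    (h : volume s = 0) : volume (st '' s) = 0 := by
  have := hl.hausdorffMeasure_image_le (d := 1) zero_le_one
  rw [hausdorffMeasure_real, h, mul_zero] at this
  exact le_antisymm this zero_le

lemma aux_cov {E : Type*} [NormedAddCommGroup E] [NormedSpace ℝ E]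
    {st : ℝ → ℝ} {T : ℝ} (hT : 0 ≤ T) {K : ℝ≥0}
    (hl : LipschitzOnWith K st (Icc 0 T)) (hm : MonotoneOn st (Icc 0 T)) (h0 : st 0 = 0)
    (G : ℝ → E) :
    ∫ r in (0:ℝ)..st T, G r = ∫ r in (0:ℝ)..T, deriv st r • G (st r) := by
  set A := Ioo 0 T ∩ {r | DifferentiableAt ℝ st r} with hA
  have hAm : MeasurableSet A := measurableSet_Ioo.inter (measurableSet_of_differentiableAt ℝ st)
  have hAs : A ⊆ Icc 0 T := fun r hr => ⟨hr.1.1.le, hr.1.2.le⟩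
  have key := integral_image_eq_integral_deriv_smul_of_monotoneOn (f := st) (f' := deriv st) hAm
    (fun r hr => hr.2.hasDerivAt.hasDerivWithinAt) (hm.mono hAs) G
  have hT0 : 0 ≤ st T := h0 ▸ hm ⟨le_rfl, hT⟩ ⟨hT, le_rfl⟩ hT
  have hAnull : volume (Icc 0 T \ A) = 0 := by
    have hd : ∀ᵐ r : ℝ, r ∉ Icc 0 T \ A := by
      have hne : ∀ᵐ r : ℝ, r ≠ T := by simp [ae_iff]
      have hne0 : ∀ᵐ r : ℝ, r ≠ 0 := by simp [ae_iff]
      filter_upwards [aux_diff_ae hl, hne, hne0] with r hr h1 h2 h3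
      have hr' : r ∈ Ioo 0 T := ⟨lt_of_le_of_ne h3.1.1 h2.symm, lt_of_le_of_ne h3.1.2 h1⟩
      exact h3.2 ⟨hr', hr hr'⟩
    exact measure_eq_zero_iff_ae_notMem.2 hd
  have e1 : (A : Set ℝ) =ᵐ[volume] Icc 0 T :=
    (LE.le.eventuallyLE hAs).antisymm (ae_le_set.2 hAnull)
  have himg : st '' Icc 0 T = Icc 0 (st T) := by
    apply Subset.antisymm
    · rintro _ ⟨r, hr, rfl⟩
      exact ⟨h0 ▸ hm ⟨le_rfl, hT⟩ hr hr.1, hm hr ⟨hT, le_rfl⟩ hr.2⟩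
    · have := intermediate_value_Icc hT hl.continuousOn
      rwa [h0] at this
  have e2 : (st '' A : Set ℝ) =ᵐ[volume] Icc 0 (st T) := by
    rw [← himg]
    refine (LE.le.eventuallyLE (image_mono hAs)).antisymm (ae_le_set.2 ?_)
    refine measure_mono_null (t := st '' (Icc 0 T \ A))
      (by rintro _ ⟨⟨r, hr, rfl⟩, h⟩; exact ⟨r, ⟨hr, fun hA => h ⟨r, hA, rfl⟩⟩, rfl⟩)
      (aux_image_null (hl.mono sdiff_subset) hAnull)
  rw [intervalIntegral.integral_of_le hT0, intervalIntegral.integral_of_le hT,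
    ← integral_Icc_eq_integral_Ioc, ← integral_Icc_eq_integral_Ioc,
    ← setIntegral_congr_set e1, ← setIntegral_congr_set e2, key]

lemma aux_contOn_g {n m : ℕ} {U : Set (EuclideanSpace ℝ (Fin m))}
    {g : EuclideanSpace ℝ (Fin n) → EuclideanSpace ℝ (Fin m) → EuclideanSpace ℝ (Fin n)}
    (h : ∀ R > (0:ℝ), ∃ L ≥ (0:ℝ), ∀ x1 x2 : EuclideanSpace ℝ (Fin n),
      ∀ u1 ∈ U, ∀ u2 ∈ U, ‖x1‖ ≤ R → ‖x2‖ ≤ R →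
      ‖g x1 u1 - g x2 u2‖ ≤ L * (‖x1 - x2‖ + ‖u1 - u2‖)) :
    ContinuousOn (fun p : EuclideanSpace ℝ (Fin n) × EuclideanSpace ℝ (Fin m) => g p.1 p.2)
      (univ ×ˢ U) := by
  intro p hp
  obtain ⟨L, hL, h⟩ := h (‖p.1‖ + 1) (by positivity)
  rw [ContinuousWithinAt, tendsto_iff_norm_sub_tendsto_zero]
  have hb : Tendsto (fun z : EuclideanSpace ℝ (Fin n) × EuclideanSpace ℝ (Fin m) =>
      L * (‖z.1 - p.1‖ + ‖z.2 - p.2‖)) (𝓝[univ ×ˢ U] p) (𝓝 0) := by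
    have hc : Continuous (fun z : EuclideanSpace ℝ (Fin n) × EuclideanSpace ℝ (Fin m) =>
      L * (‖z.1 - p.1‖ + ‖z.2 - p.2‖)) := by fun_prop
    have := hc.tendsto p
    simp only [sub_self, norm_zero, add_zero, mul_zero] at this
    exact this.mono_left nhdsWithin_le_nhds
  refine squeeze_zero' (Eventually.of_forall fun _ => norm_nonneg _) ?_ hb
  have hn : ∀ᶠ z in 𝓝[univ ×ˢ U] p, ‖z.1‖ < ‖p.1‖ + 1 :=
    nhdsWithin_le_nhds ((continuous_fst.norm.tendsto p).eventually_lt_const (lt_add_one _))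
  filter_upwards [hn, self_mem_nhdsWithin] with z hz hzU
  exact h _ _ _ hzU.2 _ hp.2 hz.le (by linarith)

lemma aux_meas_comp {α β γ : Type*} [MeasurableSpace α] {μ : Measure α}
    [TopologicalSpace β] [MeasurableSpace β] [BorelSpace β]
    [NormedAddCommGroup γ] [MeasurableSpace γ] [BorelSpace γ]
    {G : β → γ} {s : Set β} (hs : MeasurableSet s)
    (hG : ContinuousOn G s) {p : α → β} (hp : AEMeasurable p μ) (hps : ∀ᵐ a ∂μ, p a ∈ s) :
    AEMeasurable (fun a => G (p a)) μ := by
  classical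
  have h1 : Measurable (s.piecewise G (fun _ => 0)) :=
    hG.measurable_piecewise continuousOn_const hs
  refine (h1.comp_aemeasurable hp).congr ?_
  filter_upwards [hps] with a ha
  simp [Set.piecewise_eq_of_mem _ _ _ ha]

/-- Parameter-free character of the space-time system: if `(φ₀,φ,ψ) = (φ̃₀,φ̃,ψ̃) ∘ s̃`
for a nondecreasing, surjective, Lipschitz reparametrization `s̃ : [0,S) → [0,S̃)`, then
the corresponding space-time solutions satisfy `ξ = ξ̃ ∘ s̃`. -/
theorem stmt17 {n m q : ℕ}
    (U : Set (EuclideanSpace ℝ (Fin m))) (V : Set (EuclideanSpace ℝ (Fin q)))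
    (g0 : EuclideanSpace ℝ (Fin n) → EuclideanSpace ℝ (Fin m) → EuclideanSpace ℝ (Fin q) →
      EuclideanSpace ℝ (Fin n))
    (g : Fin m → EuclideanSpace ℝ (Fin n) → EuclideanSpace ℝ (Fin m) →
      EuclideanSpace ℝ (Fin n))
    (M : ℝ) (hst : StandingHyp U V g0 g M)
    (x0bar : EuclideanSpace ℝ (Fin n))
    -- the domains [0,S) and [0,S̃), with 0 < S, S̃ ≤ +∞
    (S St : ℝ≥0∞) (hS : 0 < S) (hSt : 0 < St)
    (D Dt : Set ℝ)
    (hD : D = {s : ℝ | 0 ≤ s ∧ ENNReal.ofReal s < S})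
    (hDt : Dt = {s : ℝ | 0 ≤ s ∧ ENNReal.ofReal s < St})
    -- the Lipschitz space-time control (φ̃₀,φ̃,ψ̃) on [0,S̃)
    (phi0t : ℝ → ℝ) (phit : ℝ → EuclideanSpace ℝ (Fin m))
    (psit : ℝ → EuclideanSpace ℝ (Fin q)) (K : ℝ≥0)
    (hlip : LipschitzOnWith K (fun s => (phi0t s, phit s)) Dt)
    (hmono : MonotoneOn phi0t Dt) (h00 : phi0t 0 = 0)
    (hphiU : ∀ s ∈ Dt, phit s ∈ U)
    (hpsim : Measurable psit) (hpsiV : ∀ s ∈ Dt, psit s ∈ V)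
    -- ξ̃ : the corresponding space-time solution
    (xit : ℝ → EuclideanSpace ℝ (Fin n))
    (hxit : IsSTSol g0 g x0bar phi0t phit psit xit Dt)
    -- s̃ : [0,S) → [0,S̃) nondecreasing, surjective, Lipschitz
    (st : ℝ → ℝ) (K' : ℝ≥0) (hstlip : LipschitzOnWith K' st D)
    (hstmono : MonotoneOn st D) (hstmaps : MapsTo st D Dt) (hstsurj : SurjOn st D Dt)
    -- ξ : the space-time solution corresponding to (φ₀,φ,ψ) := (φ̃₀,φ̃,ψ̃) ∘ s̃
    (xi : ℝ → EuclideanSpace ℝ (Fin n))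
    (hxi : IsSTSol g0 g x0bar (fun s => phi0t (st s)) (fun s => phit (st s))
      (fun s => psit (st s)) xi D) :
    ∀ s ∈ D, xi s = xit (st s) := by
  obtain ⟨hU, hV, hg0c, hg0l, hgl, hM, hgr⟩ := hst
  -- basic facts on the domains
  have hIcc : ∀ s ∈ D, Icc 0 s ⊆ D := by
    intro s hs t ht
    rw [hD] at hs ⊢
    exact ⟨ht.1, (ENNReal.ofReal_le_ofReal ht.2).trans_lt hs.2⟩
  have hIcct : ∀ s ∈ Dt, Icc 0 s ⊆ Dt := by
    intro s hs t ht
    rw [hDt] at hs ⊢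
    exact ⟨ht.1, (ENNReal.ofReal_le_ofReal ht.2).trans_lt hs.2⟩
  have hD0 : ∀ s ∈ D, 0 ≤ s := fun s hs => by rw [hD] at hs; exact hs.1
  have hDt0 : ∀ s ∈ Dt, 0 ≤ s := fun s hs => by rw [hDt] at hs; exact hs.1
  have h0D : (0:ℝ) ∈ D := by rw [hD]; exact ⟨le_rfl, by simpa using hS⟩
  have h0Dt : (0:ℝ) ∈ Dt := by rw [hDt]; exact ⟨le_rfl, by simpa using hSt⟩
  have hst0 : st 0 = 0 := by
    obtain ⟨s, hs, hs0⟩ := hstsurj h0Dt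
    refine le_antisymm ?_ (hDt0 _ (hstmaps h0D))
    exact (hstmono h0D hs (hD0 s hs)).trans hs0.le
  have hl0 : LipschitzOnWith K phi0t Dt := by
    have := LipschitzWith.prod_fst (α := ℝ) (β := EuclideanSpace ℝ (Fin m)) |>.comp_lipschitzOnWith hlip
    simpa [Function.comp_def] using this
  have hl1 : LipschitzOnWith K phit Dt := by
    have := LipschitzWith.prod_snd (α := ℝ) (β := EuclideanSpace ℝ (Fin m)) |>.comp_lipschitzOnWith hlip
    simpa [Function.comp_def] using this
  have hl0c : LipschitzOnWith (K * K') (fun s => phi0t (st s)) D := hl0.comp hstlip hstmaps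
  have hl1c : LipschitzOnWith (K * K') (fun s => phit (st s)) D := hl1.comp hstlip hstmaps
  have hnd : ∀ T ∈ D, ∀ r ∈ Ioo 0 T, D ∈ 𝓝 r := fun T hT r hr =>
    mem_of_superset (Icc_mem_nhds hr.1 hr.2) (hIcc T hT)
  -- `xit ∘ st` solves the reparametrized equation
  have hsol : IsSTSol g0 g x0bar (fun s => phi0t (st s)) (fun s => phit (st s))
      (fun s => psit (st s)) (fun s => xit (st s)) D := by
    intro T hT
    have hl := hstlip.mono (hIcc T hT)
    have hm := hstmono.mono (hIcc T hT)
    show xit (st T) = _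
    rw [hxit (st T) (hstmaps hT), aux_cov (hD0 T hT) hl hm hst0]
    congr 1
    set N := Ioo 0 (st T) ∩ ({r | DifferentiableAt ℝ phi0t r} ∩ {r | DifferentiableAt ℝ phit r})ᶜ
      with hN
    have hNm : MeasurableSet N := measurableSet_Ioo.inter
      ((measurableSet_of_differentiableAt ℝ phi0t).inter
        (measurableSet_of_differentiableAt ℝ phit)).compl
    have hN0 : volume N = 0 := by
      refine measure_eq_zero_iff_ae_notMem.2 ?_
      filter_upwards [aux_diff_ae (hl0.mono (hIcct _ (hstmaps hT))),
        aux_diff_ae (hl1.mono (hIcct _ (hstmaps hT)))] with r h1 h2 h3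
      exact h3.2 ⟨h1 h3.1, h2 h3.1⟩
    have hN' : volume (N ∪ {0, st T}) = 0 :=
      measure_union_null hN0 ((Set.toFinite _).measure_zero _)
    have hNm' : MeasurableSet (N ∪ {0, st T}) := hNm.union (Set.toFinite _).measurableSet
    refine intervalIntegral.integral_congr_ae ?_
    have hne : ∀ᵐ r : ℝ, r ≠ T := by simp [ae_iff]
    filter_upwards [aux_null hl hm hNm' hN', hne] with r h1 h2 hr
    rw [uIoc_of_le (hD0 T hT)] at hr
    have hr' : r ∈ Ioo 0 T := ⟨hr.1, lt_of_le_of_ne hr.2 h2⟩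
    obtain ⟨hd, hz⟩ := h1 hr'
    have hcase : (DifferentiableAt ℝ phi0t (st r) ∧ DifferentiableAt ℝ phit (st r)) ∨
        deriv st r = 0 := by
      by_cases hc : st r ∈ N ∪ {0, st T}
      · exact Or.inr (hz hc)
      · left
        have hrD := hIcc T hT ⟨hr.1.le, hr.2⟩
        have a1 : 0 ≤ st r := hDt0 _ (hstmaps hrD)
        have a2 : st r ≤ st T := hstmono hrD hT hr.2
        by_contra hcon
        apply hc
        by_cases b1 : st r = 0
        · right; simp [b1]
        by_cases b2 : st r = st T
        · right; simp [b2]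
        exact Or.inl ⟨⟨lt_of_le_of_ne a1 (Ne.symm b1), lt_of_le_of_ne a2 b2⟩, fun hh => hcon hh⟩
    have e0 := aux_chain (hnd T hT r hr') hstmaps hl0 hd (hcase.imp_left And.left)
    have e1 := aux_chain (hnd T hT r hr') hstmaps hl1 hd (hcase.imp_left And.right)
    rw [e0, e1, smul_add, Finset.smul_sum, smul_smul]
    simp only [PiLp.smul_apply, smul_smul, smul_eq_mul]
  -- uniqueness
  intro T hT
  have hT0 := hD0 T hT
  obtain ⟨BU', hBU'⟩ := hU.isBounded.exists_norm_le
  set BU := max BU' 0 with hBUdef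
  have hBU0 : 0 ≤ BU := le_max_right _ _
  have hBU : ∀ u ∈ U, ‖u‖ ≤ BU := fun u hu => (hBU' u hu).trans (le_max_left _ _)
  have hgrow : ∀ (x : EuclideanSpace ℝ (Fin n)), ∀ u ∈ U, ∀ v ∈ V,
      Real.sqrt (‖g0 x u v‖ ^ 2 + ∑ i, ‖g i x u‖ ^ 2) ≤ M * (1 + BU) * (1 + ‖x‖) := by
    intro x u hu v hv
    refine (hgr x u hu v hv).trans ?_
    have h1 : Real.sqrt (‖x‖ ^ 2 + ‖u‖ ^ 2) ≤ ‖x‖ + BU := by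
      refine Real.sqrt_le_iff.2 ⟨by positivity, ?_⟩
      have := hBU u hu
      nlinarith [norm_nonneg x, norm_nonneg u, mul_nonneg (norm_nonneg x) hBU0]
    rw [mul_assoc]
    refine mul_le_mul_of_nonneg_left ?_ hM.le
    nlinarith [mul_nonneg (norm_nonneg x) hBU0]
  have hgrow0 : ∀ (x : EuclideanSpace ℝ (Fin n)), ∀ u ∈ U, ∀ v ∈ V,
      ‖g0 x u v‖ ≤ M * (1 + BU) * (1 + ‖x‖) := by
    intro x u hu v hv
    refine le_trans (Real.le_sqrt_of_sq_le ?_) (hgrow x u hu v hv)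
    have : 0 ≤ ∑ i, ‖g i x u‖ ^ 2 := Finset.sum_nonneg fun i _ => by positivity
    linarith
  have hgrowi : ∀ (x : EuclideanSpace ℝ (Fin n)), ∀ u ∈ U, ∀ v ∈ V, ∀ i,
      ‖g i x u‖ ≤ M * (1 + BU) * (1 + ‖x‖) := by
    intro x u hu v hv i
    refine le_trans (Real.le_sqrt_of_sq_le ?_) (hgrow x u hu v hv)
    have : ‖g i x u‖ ^ 2 ≤ ∑ i, ‖g i x u‖ ^ 2 :=
      Finset.single_le_sum (f := fun i => ‖g i x u‖ ^ 2) (fun i _ => by positivity)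
        (Finset.mem_univ i)
    have : 0 ≤ ‖g0 x u v‖ ^ 2 := by positivity
    linarith
  set F : ℝ → EuclideanSpace ℝ (Fin n) → EuclideanSpace ℝ (Fin n) := fun r x =>
    (deriv (fun s => phi0t (st s)) r) • g0 x (phit (st r)) (psit (st r)) +
      ∑ i, ((deriv (fun s => phit (st s)) r) i) • g i x (phit (st r)) with hF
  have hd0 : ∀ r ∈ Ioo 0 T, ‖deriv (fun s => phi0t (st s)) r‖ ≤ (K * K' : ℝ≥0) := fun r hr =>
    norm_deriv_le_of_lipschitzOn (hnd T hT r hr) hl0c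
  have hd1 : ∀ r ∈ Ioo 0 T, ∀ i, ‖(deriv (fun s => phit (st s)) r) i‖ ≤ (K * K' : ℝ≥0) :=
    fun r hr i => (PiLp.norm_apply_le _ i).trans
      (norm_deriv_le_of_lipschitzOn (hnd T hT r hr) hl1c)
  set κ : ℝ := ((K * K' : ℝ≥0) : ℝ) with hκ
  have hκ0 : 0 ≤ κ := NNReal.coe_nonneg _
  have hrD : ∀ r ∈ Ioc 0 T, r ∈ D := fun r hr => hIcc T hT ⟨hr.1.le, hr.2⟩
  have hrU : ∀ r ∈ Ioc 0 T, phit (st r) ∈ U := fun r hr => hphiU _ (hstmaps (hrD r hr))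
  have hrV : ∀ r ∈ Ioc 0 T, psit (st r) ∈ V := fun r hr => hpsiV _ (hstmaps (hrD r hr))
  refine aux_unique (F := F) (C := (1 + m) * κ * (M * (1 + BU))) (x0 := x0bar) (x := xi)
    (y := fun s => xit (st s)) (T := T) (by positivity) hT0 ?_ ?_ ?_
    (fun s hs => hxi s (hIcc T hT hs)) (fun s hs => hsol s (hIcc T hT hs))
  · -- measurability
    intro x hx
    have hxm := hx.aemeasurable
    have hsub : Ioc 0 T ⊆ D := fun r hr => hrD r hr
    have hstm : AEMeasurable st (volume.restrict (Ioc 0 T)) :=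
      (hstlip.continuousOn.mono hsub).aemeasurable measurableSet_Ioc
    have hphm : AEMeasurable (fun r => phit (st r)) (volume.restrict (Ioc 0 T)) :=
      (hl1c.continuousOn.mono hsub).aemeasurable measurableSet_Ioc
    have hpsm : AEMeasurable (fun r => psit (st r)) (volume.restrict (Ioc 0 T)) :=
      hpsim.comp_aemeasurable hstm
    have hm0 : AEMeasurable (fun r => g0 (x r) (phit (st r)) (psit (st r)))
        (volume.restrict (Ioc 0 T)) :=
      aux_meas_comp ((MeasurableSet.univ.prod hU.measurableSet).prod hV.measurableSet) hg0c
        (p := fun r => ((x r, phit (st r)), psit (st r))) ((hxm.prodMk hphm).prodMk hpsm)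
        ((ae_restrict_iff' measurableSet_Ioc).2
          (Eventually.of_forall fun r hr => ⟨⟨mem_univ _, hrU r hr⟩, hrV r hr⟩))
    have hmi : ∀ i, AEMeasurable (fun r => g i (x r) (phit (st r)))
        (volume.restrict (Ioc 0 T)) := fun i =>
      aux_meas_comp (MeasurableSet.univ.prod hU.measurableSet) (aux_contOn_g (hgl i))
        (p := fun r => (x r, phit (st r))) (hxm.prodMk hphm)
        ((ae_restrict_iff' measurableSet_Ioc).2
          (Eventually.of_forall fun r hr => ⟨mem_univ _, hrU r hr⟩))
    refine AEMeasurable.aestronglyMeasurable ?_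
    refine AEMeasurable.add
      ((measurable_deriv (fun s => phi0t (st s))).aemeasurable.smul hm0) ?_
    refine Finset.aemeasurable_fun_sum _ fun i _ => ?_
    have : Measurable fun r => (deriv (fun s => phit (st s)) r) i := by
      have := measurable_deriv (fun s => phit (st s))
      fun_prop
    exact this.aemeasurable.smul (hmi i)
  · -- growth
    intro r hr x
    have hr' : r ∈ Ioc 0 T := ⟨hr.1, hr.2.le⟩
    set Q := M * (1 + BU) * (1 + ‖x‖) with hQ
    have hQ0 : 0 ≤ Q := by positivity
    calc ‖F r x‖ ≤ ‖(deriv (fun s => phi0t (st s)) r) • g0 x (phit (st r)) (psit (st r))‖ +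
        ∑ i, ‖((deriv (fun s => phit (st s)) r) i) • g i x (phit (st r))‖ :=
          (norm_add_le _ _).trans (add_le_add le_rfl (norm_sum_le _ _))
      _ ≤ κ * Q + ∑ _i : Fin m, κ * Q := by
          refine add_le_add ?_ (Finset.sum_le_sum fun i _ => ?_)
          · rw [norm_smul]
            exact mul_le_mul (hd0 r hr) (hgrow0 x _ (hrU r hr') _ (hrV r hr')) (norm_nonneg _) hκ0
          · rw [norm_smul]
            exact mul_le_mul (hd1 r hr i) (hgrowi x _ (hrU r hr') _ (hrV r hr') i)
              (norm_nonneg _) hκ0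
      _ = (1 + m) * κ * (M * (1 + BU)) * (1 + ‖x‖) := by
          simp [hQ]
          ring
  · -- Lipschitz
    intro R hR
    obtain ⟨L0, hL0, hlip0⟩ := hg0l R hR
    choose L hL hlipi using fun i => hgl i R hR
    refine ⟨κ * (L0 + ∑ i, L i), mul_nonneg hκ0 (add_nonneg hL0
      (Finset.sum_nonneg fun i _ => hL i)), ?_⟩
    intro r hr x y hx hy
    have hr' : r ∈ Ioc 0 T := ⟨hr.1, hr.2.le⟩
    have hu := hrU r hr'
    have e : F r x - F r y = (deriv (fun s => phi0t (st s)) r) •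
        (g0 x (phit (st r)) (psit (st r)) - g0 y (phit (st r)) (psit (st r))) +
        ∑ i, ((deriv (fun s => phit (st s)) r) i) •
          (g i x (phit (st r)) - g i y (phit (st r))) := by
      simp only [hF, smul_sub, Finset.sum_sub_distrib]
      abel
    rw [e]
    calc _ ≤ ‖(deriv (fun s => phi0t (st s)) r) •
        (g0 x (phit (st r)) (psit (st r)) - g0 y (phit (st r)) (psit (st r)))‖ +
        ∑ i, ‖((deriv (fun s => phit (st s)) r) i) •
          (g i x (phit (st r)) - g i y (phit (st r)))‖ :=
          (norm_add_le _ _).trans (add_le_add le_rfl (norm_sum_le _ _))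
      _ ≤ κ * (L0 * ‖x - y‖) + ∑ i, κ * (L i * ‖x - y‖) := by
          refine add_le_add ?_ (Finset.sum_le_sum fun i _ => ?_)
          · rw [norm_smul]
            refine mul_le_mul (hd0 r hr) ?_ (norm_nonneg _) hκ0
            simpa using hlip0 _ (hrV r hr') x y _ hu _ hu hx hy
          · rw [norm_smul]
            refine mul_le_mul (hd1 r hr i) ?_ (norm_nonneg _) hκ0
            simpa using hlipi i x y _ hu _ hu hx hy
      _ = κ * (L0 + ∑ i, L i) * ‖x - y‖ := by
          rw [← Finset.mul_sum, ← Finset.sum_mul]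
          ring

end
end
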